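/- arXiv:math/9912164 — 5 statements merged into one kernel-verified Lean document; each statement's English description precedes it below -/
import Mathlib

section
/- Let k be a perfect field of characteristic p > 0 and let O_K ≅ k[[s]] ⊂ O_L ≅ k[[t]] be a finite separable totally ramified extension of complete discrete valuation rings of degree p^n with trivial residue extension; set μ = deg𝔇_{L/K} − p^n + 1. Let g ∈ K = Frac(O_K) be nonzero with v_K(g) prime to p. Then there exist g_1, g_0 ∈ L = Frac(O_L) such that g = g_1^p + g_0 and v_L(g_0) = p^n · v_K(g) + μ. -/
set_option synthInstance.maxHeartbeats 1000000
set_option maxHeartbeats 1600000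

namespace PowerSeries

section PerfectCoefficients

variable {k : Type*} [Field k] [PerfectField k] (p : ℕ) [Fact p.Prime] [CharP k p]

include p

/-- Over a perfect field of characteristic `p`, a power series in `X ^ p` is a `p`-th power. -/
theorem exists_pow_eq_of_coeff_eq_zero (x : PowerSeries k)
    (hx : ∀ j, ¬ p ∣ j → coeff j x = 0) : ∃ y : PowerSeries k, y ^ p = x := by
  have hp : p ≠ 0 := (Fact.out : p.Prime).ne_zero
  refine ⟨mk fun j => (frobeniusEquiv k p).symm (coeff (p * j) x), ?_⟩
  refine (MvPowerSeries.map_frobenius_expand p hp).symm.trans ?_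
  ext j
  change coeff j (map (frobenius k p) (expand p hp _)) = _
  rw [coeff_map, coeff_expand]
  split_ifs with h
  · obtain ⟨i, rfl⟩ := h
    rw [Nat.mul_div_cancel_left _ (Nat.pos_of_ne_zero hp), coeff_mk,
      frobenius_apply_frobeniusEquiv_symm]
  · rw [map_zero, hx j h]

/-- Over a perfect field of characteristic `p`, the powers `1, X, …, X ^ (p - 1)` generate the
power series ring over its subring of `p`-th powers. -/
theorem exists_eq_sum_pow_mul_X_pow (x : PowerSeries k) :
    ∃ y : ℕ → PowerSeries k, x = ∑ i ∈ Finset.range p, y i ^ p * X ^ i := by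
  have hp : 0 < p := (Fact.out : p.Prime).pos
  have h (i : ℕ) : ∃ y : PowerSeries k,
      y ^ p = mk fun j => if p ∣ j then coeff (j + i) x else 0 :=
    exists_pow_eq_of_coeff_eq_zero p _ fun j hj => by rw [coeff_mk, if_neg hj]
  choose y hy using h
  refine ⟨y, ?_⟩
  ext m
  rw [map_sum, Finset.sum_eq_single (m % p)]
  · rw [hy, coeff_mul_X_pow', if_pos (Nat.mod_le m p), coeff_mk, if_pos (Nat.dvd_sub_mod m),
      Nat.sub_add_cancel (Nat.mod_le m p)]
  · intro i hi him
    rw [hy, coeff_mul_X_pow']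
    split_ifs with hle
    · rw [coeff_mk, if_neg]
      intro hdvd
      apply him
      rw [← Nat.mod_eq_of_lt (Finset.mem_range.mp hi)]
      exact (Nat.modEq_iff_dvd' hle).mpr hdvd
    · rfl
  · intro h
    exact absurd (Finset.mem_range.mpr (Nat.mod_lt m hp)) h

/-- Over a perfect field of characteristic `p`, a derivation on power series (with values in a
module over the target of a ring homomorphism) which kills `X` is zero. -/
theorem eq_zero_of_leibniz {B M : Type*} [CommRing B] [AddCommGroup M] [Module B M]
    (φ : PowerSeries k →+* B) (E : PowerSeries k →+ M)
    (hE : ∀ a b, E (a * b) = φ a • E b + φ b • E a) (hX : E X = 0) (a : PowerSeries k) :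
    E a = 0 := by
  have h_pow (b : PowerSeries k) (n : ℕ) : E (b ^ n) = (n : B) • φ b ^ (n - 1) • E b := by
    induction n with
    | zero =>
      have h := hE 1 1
      simp only [map_one, one_smul, mul_one, left_eq_add] at h
      simp [h]
    | succ n ih =>
      rw [pow_succ, hE, ih, smul_smul, smul_smul, smul_smul, ← add_smul, map_pow]
      congr 1
      cases n with
      | zero => simp
      | succ n => push_cast [Nat.add_sub_cancel]; ring
  have hp : (p : B) = 0 := by
    have h : (p : PowerSeries k) = 0 := by
      rw [← map_natCast (C (R := k)), CharP.cast_eq_zero, map_zero]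
    rw [← map_natCast φ, h, map_zero]
  obtain ⟨y, rfl⟩ := exists_eq_sum_pow_mul_X_pow p a
  rw [map_sum]
  refine Finset.sum_eq_zero fun i _ => ?_
  rw [hE, h_pow X, h_pow (y i) p, hp, hX]
  simp

/-- The chain rule for ring homomorphisms between power series rings over a perfect field. -/
theorem derivative_map_eq (f : PowerSeries k →+* PowerSeries k) (a : PowerSeries k) :
    derivative k (f a) = f (derivative k a) * derivative k (f X) := by
  let E : PowerSeries k →+ PowerSeries k :=
    { toFun := fun a => derivative k (f a) - f (derivative k a) * derivative k (f X)
      map_zero' := by simp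
      map_add' := fun a b => by simp only [map_add]; ring }
  refine sub_eq_zero.mp (eq_zero_of_leibniz p f E (fun a b => ?_) ?_ a)
  · change derivative k (f (a * b)) - f (derivative k (a * b)) * _ = f a • (_ - _) + f b • (_ - _)
    simp only [map_mul, Derivation.leibniz, map_add, smul_eq_mul]
    ring
  · change derivative k (f X) - f (derivative k X) * _ = 0
    rw [derivative_X, map_one, one_mul, sub_self]

/-- If the derivative of `h` has order `m`, then `h` is the sum of a `p`-th power and a power
series of order `m + 1`. -/
theorem exists_eq_pow_add_of_order_derivative (h : PowerSeries k) (m : ℕ)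
    (hm : order (derivative k h) = m) :
    ∃ h₁ h₀ : PowerSeries k, h = h₁ ^ p + h₀ ∧ order h₀ = (m + 1 : ℕ) := by
  obtain ⟨hm0, hlt⟩ := order_eq_nat.mp hm
  rw [coeff_derivative] at hm0
  obtain ⟨h₁, hh₁⟩ := exists_pow_eq_of_coeff_eq_zero p
    (mk fun j => if j < m + 1 then coeff j h else 0) fun j hj => by
      rw [coeff_mk]
      split_ifs with hjm
      · obtain _ | i := j
        · simp at hj
        · have hi := hlt i (by omega)
          rw [coeff_derivative, mul_eq_zero] at hi
          refine hi.resolve_right fun h0 => hj ?_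
          rw [← CharP.cast_eq_zero_iff k p]
          exact_mod_cast h0
      · rfl
  refine ⟨h₁, h - h₁ ^ p, by ring, order_eq_nat.mpr ⟨?_, fun i hi => ?_⟩⟩
  · rw [map_sub, hh₁, coeff_mk, if_neg (lt_irrefl _), sub_zero]
    exact left_ne_zero_of_mul hm0
  · rw [map_sub, hh₁, coeff_mk, if_pos hi, sub_self]

/-- The annihilator of the Kähler differentials of `k⟦X⟧` over the image of an endomorphism `f`
is generated by the derivative of `f X`. -/
theorem annihilator_kaehlerDifferential_eq_span {A B : Type*} [CommRing A] [CommRing B]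
    [Algebra A B] (f : PowerSeries k →+* PowerSeries k) (e : PowerSeries k ≃+* B)
    (hA : ∀ b, b ∈ Set.range (algebraMap A B) ↔ ∃ a, e (f a) = b) :
    Module.annihilator B (KaehlerDifferential A B) =
      Ideal.span {e (derivative k (f X))} := by
  set I : Ideal B := Ideal.span {e (derivative k (f X))}
  apply le_antisymm
  · have hker (a : A) : Ideal.Quotient.mk I (e (derivative k (e.symm (algebraMap A B a)))) = 0 := by
      obtain ⟨c, hc⟩ := (hA _).mp ⟨a, rfl⟩
      rw [← hc, e.symm_apply_apply, derivative_map_eq p, map_mul,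
        Ideal.Quotient.eq_zero_iff_mem]
      exact I.mul_mem_left _ (Ideal.mem_span_singleton_self _)
    let D : Derivation A B (B ⧸ I) := Derivation.mk'
      { toFun := fun b => Ideal.Quotient.mk I (e (derivative k (e.symm b)))
        map_add' := fun x y => by simp only [map_add]
        map_smul' := fun a b => by
          rw [Algebra.smul_def a b, map_mul, Derivation.leibniz, map_add, map_add, smul_eq_mul,
            smul_eq_mul, map_mul, map_mul, map_mul, map_mul, hker a, mul_zero, add_zero,
            e.apply_symm_apply, RingHom.id_apply, Algebra.smul_def]
          rfl }
      (fun a b => by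
        simp only [LinearMap.coe_mk, AddHom.coe_mk, map_mul, Derivation.leibniz, smul_eq_mul,
          map_add, RingEquiv.apply_symm_apply]
        rfl)
    intro b hb
    have h1 : D (e X) = 1 := by
      change Ideal.Quotient.mk I (e (derivative k (e.symm (e X)))) = 1
      simp
    have h2 : b • D (e X) = 0 := by
      rw [← Derivation.liftKaehlerDifferential_comp_D, ← map_smul,
        Module.mem_annihilator.mp hb, map_zero]
    rw [h1, Algebra.smul_def, mul_one] at h2
    exact Ideal.Quotient.eq_zero_iff_mem.mp h2
  · let dX := KaehlerDifferential.D A B (e X)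
    let E : PowerSeries k →+ KaehlerDifferential A B :=
      { toFun := fun a => KaehlerDifferential.D A B (e a) - e (derivative k a) • dX
        map_zero' := by simp
        map_add' := fun a b => by simp only [map_add, add_smul]; abel }
    have hD (a : PowerSeries k) :
        KaehlerDifferential.D A B (e a) = e (derivative k a) • dX := by
      refine sub_eq_zero.mp (eq_zero_of_leibniz p (e : PowerSeries k →+* B) E
        (fun a b => ?_) ?_ a)
      · change KaehlerDifferential.D A B (e (a * b)) - e (derivative k (a * b)) • dX =
          e a • (_ - _) + e b • (_ - _)
        simp only [map_mul, Derivation.leibniz, map_add, smul_eq_mul, smul_sub, add_smul, mul_smul]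
        abel
      · change dX - e (derivative k X) • dX = 0
        simp
    have h0 : e (derivative k (f X)) • dX = 0 := by
      obtain ⟨a, ha⟩ := (hA (e (f X))).mpr ⟨X, rfl⟩
      rw [← hD, ← ha, Derivation.map_algebraMap]
    rw [Ideal.span_le, Set.singleton_subset_iff, SetLike.mem_coe, Module.mem_annihilator]
    intro ω
    have hω : ω ∈ Submodule.span B (Set.range (KaehlerDifferential.D A B)) := by
      rw [KaehlerDifferential.span_range_derivation]; trivial
    induction hω using Submodule.span_induction with
    | mem x hx =>
      obtain ⟨b, rfl⟩ := hx
      rw [← e.apply_symm_apply b, hD, smul_comm, h0, smul_zero]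
    | zero => exact smul_zero _
    | add x y _ _ hx hy => rw [smul_add, hx, hy, add_zero]
    | smul b x _ hx => rw [smul_comm, hx, smul_zero]

end PerfectCoefficients

section Order

variable {k : Type*} [Field k]

/-- A ring endomorphism `f` of the power series ring multiplies orders by the order of `f X`. -/
theorem order_map_eq_nsmul (f : PowerSeries k →+* PowerSeries k) {u : PowerSeries k}
    (hu : IsUnit u) (m : ℕ) : order (f (X ^ m * u)) = m • order (f X) := by
  rw [map_mul, map_pow, order_mul, order_pow, order_zero_of_unit (hu.map f), add_zero]

/-- The order of a nonzero power series agrees with its order as a Laurent series. -/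
theorem order_ofPowerSeries {a : PowerSeries k} {m : ℕ} (ha : order a = m) :
    (HahnSeries.ofPowerSeries ℤ k a).order = m := by
  obtain ⟨h, hlt⟩ := order_eq_nat.mp ha
  apply le_antisymm
  · apply HahnSeries.order_le_of_coeff_ne_zero
    rwa [LaurentSeries.coeff_coe_powerSeries]
  · by_contra! hm
    have hne : HahnSeries.ofPowerSeries ℤ k a ≠ 0 := fun h0 => h <| by
      rw [HahnSeries.ofPowerSeries_injective (h0.trans (map_zero _).symm), map_zero]
    refine hne (HahnSeries.coeff_order_eq_zero.mp ?_)
    rw [coeff_coe]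
    split_ifs with hneg
    · rfl
    · exact hlt _ (by omega)

end Order

end PowerSeries

/-- Let `k` be a perfect field of characteristic `p > 0` and let
`O_K ≅ k[[s]] ⊂ O_L ≅ k[[t]]` be a finite separable totally ramified extension of complete
discrete valuation rings of degree `p^n` with trivial residue extension; set
`μ = deg𝔇_{L/K} − p^n + 1`. Let `g ∈ K` be nonzero with `v_K(g)` prime to `p`. Then there
exist `g₁, g₀ ∈ L` with `g = g₁^p + g₀` and `v_L(g₀) = p^n·v_K(g) + μ`.

Here the extension `K → L` of Laurent series fields is realized by a `k`-algebra map
`F : k((s)) → k((t))` carrying the power series ring into the power series ring, `O_K` is the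
image under `F` of the power series ring, `O_L` is the power series ring, `v_L` is the
`t`-adic order and `v_K(g)` is the `s`-adic order of `g`; the different `𝔇_{L/K}` is the
annihilator of the Kähler differentials `Ω¹_{O_L/O_K}`. -/
theorem adjustment_corollary (p n : ℕ) [Fact p.Prime] (k : Type*) [Field k] [CharP k p]
    [PerfectField k]
    (F : LaurentSeries k →ₐ[k] LaurentSeries k)
    -- `F` carries the power series ring into the power series ring
    (f : PowerSeries k →ₐ[k] PowerSeries k)
    (hFf : ∀ a : PowerSeries k,
      F (HahnSeries.ofPowerSeries ℤ k a) = HahnSeries.ofPowerSeries ℤ k (f a))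
    -- the valuation rings `O_L` and `O_K` inside `L = k((t))`
    (OL OK : Subring (LaurentSeries k))
    (hOL : ∀ x, x ∈ OL ↔ ∃ a : PowerSeries k, HahnSeries.ofPowerSeries ℤ k a = x)
    (hOK : ∀ x, x ∈ OK ↔ ∃ a : PowerSeries k, F (HahnSeries.ofPowerSeries ℤ k a) = x)
    (hle : OK ≤ OL)
    -- the extension is finite
    (hfin : letI := (Subring.inclusion hle).toAlgebra; Module.Finite ↥OK ↥OL)
    -- the field extension `L/K` is separable
    (hsep : Algebra.IsSeparable ↥F.fieldRange (LaurentSeries k))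
    -- totally ramified of degree `p^n`: the uniformizer `s` of `K` has valuation `p^n` in `L`
    (hram : (F (HahnSeries.ofPowerSeries ℤ k PowerSeries.X)).order = (p ^ n : ℤ))
    -- `d = deg𝔇_{L/K}`: the different `Ann(Ω¹_{O_L/O_K})` is the `d`-th power of the maximal
    -- ideal of `O_L`, generated by the uniformizer `t`
    (t : ↥OL) (ht : (t : LaurentSeries k) = HahnSeries.ofPowerSeries ℤ k PowerSeries.X)
    (d : ℕ)
    (hd : letI := (Subring.inclusion hle).toAlgebra;
      Module.annihilator ↥OL (KaehlerDifferential ↥OK ↥OL) = Ideal.span {t} ^ d)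
    (μ : ℤ) (hμ : μ = (d : ℤ) - p ^ n + 1)
    -- a nonzero element `g` of `K` whose valuation is prime to `p`
    (g : LaurentSeries k) (hg : g ≠ 0) (hgord : ¬ (p : ℤ) ∣ g.order) :
    ∃ g₁ g₀ : LaurentSeries k, F g = g₁ ^ p + g₀ ∧ g₀ ≠ 0 ∧
      g₀.order = p ^ n * g.order + μ := by
  have hp : p.Prime := Fact.out
  let ι := HahnSeries.ofPowerSeries ℤ k
  have hι : Function.Injective ι := HahnSeries.ofPowerSeries_injective
  set σ := f PowerSeries.X with hσ
  have hFX : F (ι PowerSeries.X) = ι σ := hFf _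
  have hFXorder : (ι σ).order = (p ^ n : ℤ) := hFX ▸ hram
  have hι0 : ι σ ≠ 0 := fun h => by
    rw [h, HahnSeries.order_zero] at hFXorder
    exact (pow_ne_zero n (by exact_mod_cast hp.ne_zero : (p : ℤ) ≠ 0)) hFXorder.symm
  have hσ0 : σ ≠ 0 := fun h => hι0 (by rw [h, map_zero])
  have hσorder : PowerSeries.order σ = (p ^ n : ℕ) := by
    rw [← PowerSeries.coe_toNat_order hσ0]
    rw [PowerSeries.order_ofPowerSeries (PowerSeries.coe_toNat_order hσ0).symm] at hFXorder
    exact_mod_cast hFXorder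
  -- the different is generated by the derivative of `σ`
  have hdorder : PowerSeries.order (PowerSeries.derivative k σ) = d := by
    let e : PowerSeries k ≃+* OL := RingEquiv.ofBijective
      (ι.codRestrict OL fun a => (hOL _).mpr ⟨a, rfl⟩)
      ⟨fun a b h => hι (congrArg Subtype.val h), fun x => by
        obtain ⟨a, ha⟩ := (hOL x).mp x.2
        exact ⟨a, Subtype.ext ha⟩⟩
    have he (a : PowerSeries k) : (e a : LaurentSeries k) = ι a := rfl
    have heX : e PowerSeries.X = t := Subtype.ext ht.symm
    let := (Subring.inclusion hle).toAlgebra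
    have hann := PowerSeries.annihilator_kaehlerDifferential_eq_span p (A := OK) (B := OL)
      (f : PowerSeries k →+* PowerSeries k) e fun b => by
        constructor
        · rintro ⟨a, rfl⟩
          obtain ⟨c, hc⟩ := (hOK a).mp a.2
          exact ⟨c, Subtype.ext ((hFf c).symm.trans hc)⟩
        · rintro ⟨c, rfl⟩
          exact ⟨⟨F (ι c), (hOK _).mpr ⟨c, rfl⟩⟩, Subtype.ext (hFf c)⟩
    rw [hd, Ideal.span_singleton_pow, Ideal.span_singleton_eq_span_singleton, ← heX,
      ← map_pow] at hann
    have hassoc : Associated (PowerSeries.X ^ d) (PowerSeries.derivative k σ) := by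
      simpa using hann.map e.symm
    obtain ⟨u, hu⟩ := hassoc
    rw [← hu, PowerSeries.order_mul, PowerSeries.order_X_pow,
      PowerSeries.order_zero_of_unit u.isUnit, add_zero]
  -- multiply `g` by a `p`-th power to reduce to power series
  set N := g.order.natAbs
  obtain ⟨q, hq⟩ : ∃ q : ℕ, (q : ℤ) = g.order + p * N := by
    refine ⟨(g.order + p * N).toNat, Int.toNat_of_nonneg ?_⟩
    have h1 : (1 : ℤ) ≤ p := by exact_mod_cast hp.one_le
    have h2 : -g.order ≤ N := by omega
    nlinarith
  have hpq : ¬ p ∣ q := fun h => hgord <| by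
    have h' : (p : ℤ) ∣ g.order + p * N := hq ▸ Int.natCast_dvd_natCast.mpr h
    exact (Int.dvd_add_left (dvd_mul_right _ _)).mp h'
  obtain ⟨r, rfl⟩ : ∃ r, q = r + 1 := Nat.exists_eq_succ_of_ne_zero fun h =>
    hpq (h ▸ dvd_zero p)
  set G : PowerSeries k := PowerSeries.X ^ (r + 1) * g.powerSeriesPart
  have hG : ι G = g * ι PowerSeries.X ^ (p * N) := by
    rw [map_mul, LaurentSeries.ofPowerSeries_powerSeriesPart, HahnSeries.ofPowerSeries_X_pow,
      ← map_pow, HahnSeries.ofPowerSeries_X_pow, ← mul_assoc, HahnSeries.single_mul_single, hq,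
      mul_comm g,
      one_mul]
    congr 2
    rw [← sub_eq_add_neg, add_sub_cancel_left, Nat.cast_mul]
  have hr : ((r : k) + 1) ≠ 0 := fun h => hpq <| by
    rw [← CharP.cast_eq_zero_iff k p]
    exact_mod_cast h
  obtain ⟨u, hu, hG'⟩ : ∃ u : PowerSeries k, IsUnit u ∧
      PowerSeries.derivative k G = PowerSeries.X ^ r * u := by
    refine ⟨PowerSeries.C ((r : k) + 1) * g.powerSeriesPart +
      PowerSeries.X * PowerSeries.derivative k g.powerSeriesPart, ?_, ?_⟩
    · rw [PowerSeries.isUnit_iff_constantCoeff]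
      have h0 : PowerSeries.constantCoeff g.powerSeriesPart ≠ 0 := by
        rw [← PowerSeries.coeff_zero_eq_constantCoeff_apply, LaurentSeries.powerSeriesPart_coeff]
        simpa using hg
      simpa using ⟨hr, h0⟩
    · rw [Derivation.leibniz, Derivation.leibniz_pow, PowerSeries.derivative_X]
      simp only [smul_eq_mul, nsmul_eq_mul, Nat.add_sub_cancel, map_add, map_natCast, map_one]
      push_cast
      ring
  have hGorder : PowerSeries.order (PowerSeries.derivative k (f G)) = (r * p ^ n + d : ℕ) := by
    have h := PowerSeries.derivative_map_eq p (f : PowerSeries k →+* PowerSeries k) G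
    have h' := PowerSeries.order_map_eq_nsmul (f : PowerSeries k →+* PowerSeries k) hu r
    simp only [RingHom.coe_coe, ← hσ] at h h'
    rw [h, PowerSeries.order_mul, hG', h', hσorder, hdorder, nsmul_eq_mul]
    push_cast
    rfl
  obtain ⟨h₁, h₀, hfG, hh₀⟩ := PowerSeries.exists_eq_pow_add_of_order_derivative p _ _ hGorder
  have hFG : F g * ι σ ^ (p * N) = ι h₁ ^ p + ι h₀ := by
    rw [← hFX, ← map_pow F, ← map_mul F, ← hG, ← map_pow ι, ← map_add ι, ← hfG]
    exact hFf G
  have hιh₀ : ι h₀ ≠ 0 := fun h => by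
    rw [hι (h.trans (map_zero ι).symm), PowerSeries.order_zero] at hh₀
    exact absurd hh₀ (ENat.top_ne_natCast _)
  have hpow : ι σ ^ (p * N) ≠ 0 := pow_ne_zero _ hι0
  have hg₀ : ι h₀ / ι σ ^ (p * N) ≠ 0 := div_ne_zero hιh₀ hpow
  refine ⟨ι h₁ / ι σ ^ N, ι h₀ / ι σ ^ (p * N), ?_, hg₀, ?_⟩
  · rw [div_pow, ← pow_mul, mul_comm N p, ← add_div, eq_div_iff hpow, hFG]
  · have h := HahnSeries.order_mul hg₀ hpow
    rw [div_mul_cancel₀ _ hpow, PowerSeries.order_ofPowerSeries hh₀, HahnSeries.order_pow,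
      hFXorder, nsmul_eq_mul] at h
    push_cast at h hq
    rw [hμ]
    linear_combination -h + (p ^ n : ℤ) * hq
end

section
/- Let K be a complete discretely valued field with perfect residue field of characteristic p > 0. Let M/K be a finite Galois totally ramified extension with group G̃, let H ⊆ G̃ be a normal subgroup of order p with G̃/H of order p^n, and let L = M^H, so L/K is Galois totally ramified of degree p^n. Let e(M/K) be the largest integer with G̃_{e(M/K)} ≠ {1}, and suppose G̃_{e(M/K)} ∩ H ≠ {1}. Let m(M/K) be the conductor exponent of M/K and μ(L/K) = deg𝔇_{L/K} − p^n + 1. Then e(M/K) = p^n · m(M/K) − μ(L/K). -/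
/-- A (rank-one) additive valuation on a field, written additively with value `⊤` at `0`. -/
def IsAddValuation {L : Type*} [Field L] (v : L → WithTop ℤ) : Prop :=
  (∀ x, v x = ⊤ ↔ x = 0) ∧ (∀ x y, v (x * y) = v x + v y) ∧
    (∀ x y, min (v x) (v y) ≤ v (x + y))

/-- The `i`-th lower ramification group `Γ_i = {σ : v(σt − t) ≥ i + 1}` of a Galois extension,
computed with respect to a valuation `v` and a uniformizer `t`. -/
def ramGroup {K L : Type*} [Field K] [Field L] [Algebra K L] (v : L → WithTop ℤ) (t : L)
    (i : ℕ) : Set (L ≃ₐ[K] L) :=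
  {σ | (((i : ℤ) + 1 : ℤ) : WithTop ℤ) ≤ v (σ t - t)}

section TotallyRamified

variable {F E : Type*} [Field F] [Field E] [Algebra F E] (w : AddValuation E (WithTop ℤ))

/-- An additive valuation in the sense of `IsAddValuation`, as a Mathlib `AddValuation`. -/
theorem IsAddValuation.exists_addValuation {v : E → WithTop ℤ} (hv : IsAddValuation v) :
    ∃ w : AddValuation E (WithTop ℤ), ∀ x, v x = w x := by
  obtain ⟨h0, hm, ha⟩ := hv
  refine ⟨AddValuation.of v ((h0 0).2 rfl) ?_ ha hm, fun x => rfl⟩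
  have h1 := hm 1 1
  have ht : v 1 ≠ ⊤ := fun h => one_ne_zero ((h0 1).1 h)
  obtain ⟨a, ha⟩ := WithTop.ne_top_iff_exists.1 ht
  rw [mul_one, ← ha] at h1
  rw [← ha]
  norm_cast at h1 ⊢
  omega

theorem AddValuation.exists_int {x : E} (hx : x ≠ 0) : ∃ a : ℤ, w x = a := by
  obtain ⟨a, ha⟩ := WithTop.ne_top_iff_exists.1 ((w.ne_top_iff).2 hx)
  exact ⟨a, ha.symm⟩

theorem AddValuation.map_pow_of_eq {x : E} {a : ℤ} (hx : w x = a) (n : ℕ) :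
    w (x ^ n) = ((n * a : ℤ) : WithTop ℤ) := by
  rw [w.map_pow, hx, ← WithTop.coe_nsmul, nsmul_eq_mul]

/-- If distinct terms of a sum have distinct valuations, none of them has smaller valuation than
the sum. -/
theorem AddValuation.map_sum_le_of_injOn {ι : Type*} [DecidableEq ι] (s : Finset ι) (g : ι → E)
    (h : ∀ i ∈ s, ∀ j ∈ s, w (g i) = w (g j) → i ≠ j → w (g i) = ⊤) :
    ∀ i ∈ s, w (∑ j ∈ s, g j) ≤ w (g i) := by
  intro i hi
  obtain ⟨k, hk, hmin⟩ := s.exists_min_image (fun j => w (g j)) ⟨i, hi⟩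
  by_cases hkt : w (g k) = ⊤
  · have : w (g i) = ⊤ := top_le_iff.1 (hkt ▸ hmin i hi)
    rw [this]
    exact le_top
  refine le_trans (le_of_eq ?_) (hmin i hi)
  rw [← Finset.add_sum_erase s g hk]
  refine w.map_add_eq_of_lt_left (w.map_lt_sum hkt fun j hj => ?_)
  obtain ⟨hjk, hjs⟩ := Finset.mem_erase.1 hj
  exact lt_of_le_of_ne (hmin j hjs) fun he => hkt (h k hk j hjs he hjk.symm)

variable {N : ℕ} (hK : ∀ x : F, x ≠ 0 → ∃ a : ℤ, w (algebraMap F E x) = ((N * a : ℤ) : WithTop ℤ))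
  {t : E} (ht : w t = 1)

include hK ht

theorem map_smul_pow {c : F} (hc : c ≠ 0) (i : ℕ) :
    ∃ a : ℤ, w (algebraMap F E c) = ((N * a : ℤ) : WithTop ℤ) ∧
      w (c • t ^ i) = ((N * a + i : ℤ) : WithTop ℤ) := by
  obtain ⟨a, ha⟩ := hK c hc
  refine ⟨a, ha, ?_⟩
  have ht' : w t = ((1 : ℤ) : WithTop ℤ) := by simpa using ht
  rw [Algebra.smul_def, w.map_mul, ha, w.map_pow_of_eq ht']
  simp

theorem map_sum_smul_pow_le (c : Fin N → F) (i : Fin N) :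
    w (∑ j, c j • t ^ (j : ℕ)) ≤ w (c i • t ^ (i : ℕ)) := by
  refine w.map_sum_le_of_injOn Finset.univ (fun j : Fin N => c j • t ^ (j : ℕ)) ?_ i
    (Finset.mem_univ i)
  intro i _ j _ he hij
  by_cases hi : c i = 0
  · simp [hi]
  by_cases hj : c j = 0
  · rw [he]; simp [hj]
  obtain ⟨a, -, ha⟩ := map_smul_pow w hK ht hi i
  obtain ⟨b, -, hb⟩ := map_smul_pow w hK ht hj j
  rw [ha, hb, WithTop.coe_inj] at he
  have h1 : (i : ℤ) < N := by exact_mod_cast i.2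
  have h2 : (j : ℤ) < N := by exact_mod_cast j.2
  exfalso
  refine hij (Fin.ext ?_)
  have : ((i : ℕ) : ℤ) = (j : ℕ) := by
    have h3 : ((N * a + i : ℤ)) % N = (N * b + j) % N := by rw [he]
    rw [Int.mul_add_emod_self_left, Int.mul_add_emod_self_left, Int.emod_eq_of_lt (by simp) h1,
      Int.emod_eq_of_lt (by simp) h2] at h3
    exact h3
  exact_mod_cast this

variable [FiniteDimensional F E] (hN : Module.finrank F E = N)

include hN

theorem exists_eq_sum_smul_pow (x : E) : ∃ c : Fin N → F, x = ∑ j, c j • t ^ (j : ℕ) := by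
  have hli : LinearIndependent F (fun j : Fin N => t ^ (j : ℕ)) := by
    rw [Fintype.linearIndependent_iff]
    intro c hc i
    by_contra hi
    obtain ⟨a, -, ha⟩ := map_smul_pow w hK ht hi i
    have := map_sum_smul_pow_le w hK ht c i
    rw [hc, w.map_zero, ha] at this
    exact WithTop.coe_ne_top (top_le_iff.1 this)
  have hpos : 0 < N := hN ▸ Module.finrank_pos
  have : Nonempty (Fin N) := ⟨⟨0, hpos⟩⟩
  let b := basisOfLinearIndependentOfCardEqFinrank hli (by simp [hN])
  refine ⟨fun j => b.repr x j, ?_⟩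
  conv_lhs => rw [← b.sum_repr x]
  simp [b]

/-- In a totally ramified extension the integral elements are the polynomials in a uniformizer with
integral coefficients. -/
theorem exists_eq_sum_smul_pow_of_nonneg {x : E} (hx : 0 ≤ w x) :
    ∃ c : Fin N → F, (∀ i, 0 ≤ w (algebraMap F E (c i))) ∧ x = ∑ j, c j • t ^ (j : ℕ) := by
  obtain ⟨c, rfl⟩ := exists_eq_sum_smul_pow w hK ht hN x
  refine ⟨c, fun i => ?_, rfl⟩
  by_cases hi : c i = 0
  · simp [hi]
  obtain ⟨a, ha', ha⟩ := map_smul_pow w hK ht hi i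
  have h := hx.trans (map_sum_smul_pow_le w hK ht c i)
  have h1 : (i : ℤ) < N := by exact_mod_cast i.2
  rw [ha']
  rw [ha] at h
  norm_cast at h ⊢
  have : 0 ≤ a := by nlinarith
  positivity

/-- A uniformizer is a root of an Eisenstein polynomial. -/
theorem exists_pow_eq_sum_smul_pow :
    ∃ c : Fin N → F, (∀ i, 0 < w (algebraMap F E (c i))) ∧ t ^ N = ∑ j, c j • t ^ (j : ℕ) := by
  obtain ⟨c, hc⟩ := exists_eq_sum_smul_pow w hK ht hN (t ^ N)
  refine ⟨c, fun i => ?_, hc⟩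
  by_cases hi : c i = 0
  · simp [hi]
  obtain ⟨a, ha', ha⟩ := map_smul_pow w hK ht hi i
  have h := map_sum_smul_pow_le w hK ht c i
  have h1 : (i : ℤ) < N := by exact_mod_cast i.2
  have ht' : w t = ((1 : ℤ) : WithTop ℤ) := by simpa using ht
  rw [ha']
  rw [ha, ← hc, w.map_pow_of_eq ht'] at h
  norm_cast at h ⊢
  push_cast at h
  nlinarith

theorem map_uniformizer_pos (σ : E ≃ₐ[F] E) : 0 < w (σ t) := by
  by_contra! hle
  obtain ⟨c, hc, he⟩ := exists_pow_eq_sum_smul_pow w hK ht hN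
  have he' := congrArg σ he
  simp only [map_pow, map_sum, map_smul] at he'
  have hne : σ t ≠ 0 := fun h => by simp [h] at hle
  obtain ⟨b, hb⟩ := w.exists_int hne
  have hlt : w (σ t ^ N) < w (∑ j, c j • σ t ^ (j : ℕ)) := by
    refine w.map_lt_sum ((w.ne_top_iff).2 (pow_ne_zero _ hne)) fun i _ => ?_
    by_cases hi : c i = 0
    · rw [hi, zero_smul, w.map_zero]
      exact lt_top_iff_ne_top.2 ((w.ne_top_iff).2 (pow_ne_zero _ hne))
    obtain ⟨a, ha⟩ := hK _ hi
    have h2 := hc i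
    rw [Algebra.smul_def, w.map_mul, w.map_pow_of_eq hb, w.map_pow_of_eq hb, ha]
    rw [ha] at h2
    rw [hb] at hle
    norm_cast at h2 hle ⊢
    have h1 : (i : ℤ) < N := by exact_mod_cast i.2
    nlinarith
  rw [← he'] at hlt
  exact lt_irrefl _ hlt

theorem map_nonneg_of_nonneg (σ : E ≃ₐ[F] E) {x : E} (hx : 0 ≤ w x) : 0 ≤ w (σ x) := by
  obtain ⟨c, hc, rfl⟩ := exists_eq_sum_smul_pow_of_nonneg w hK ht hN hx
  simp only [map_pow, map_sum, map_smul]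
  refine w.map_le_sum fun i _ => ?_
  rw [Algebra.smul_def, w.map_mul, w.map_pow]
  exact add_nonneg (hc i) (nsmul_nonneg (map_uniformizer_pos w hK ht hN σ).le _)

theorem map_uniformizer (σ : E ≃ₐ[F] E) : w (σ t) = 1 := by
  have ht' : w t = ((1 : ℤ) : WithTop ℤ) := by simpa using ht
  have ht0 : t ≠ 0 := by rintro rfl; simp at ht
  have key : ∀ τ : E ≃ₐ[F] E, w (τ.symm t) ≤ 1 := fun τ => by
    obtain ⟨a, ha⟩ := w.exists_int ((map_ne_zero τ).2 ht0)
    obtain ⟨b, hb⟩ := w.exists_int ((map_ne_zero τ.symm).2 ht0)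
    have h1 := map_uniformizer_pos w hK ht hN τ
    have h2 : 0 ≤ w (τ t * t⁻¹) := by
      have := w.map_mul (τ t * t⁻¹) t
      obtain ⟨d, hd⟩ := w.exists_int (mul_ne_zero ((map_ne_zero τ).2 ht0) (inv_ne_zero ht0))
      rw [mul_assoc, inv_mul_cancel₀ ht0, mul_one, ha, hd, ht'] at this
      rw [ha] at h1
      rw [hd]
      norm_cast at h1 this ⊢
      omega
    have h3 := map_nonneg_of_nonneg w hK ht hN τ.symm h2
    have h4 := w.map_mul (τ.symm (τ t * t⁻¹)) (τ.symm t)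
    rw [← map_mul, mul_assoc, inv_mul_cancel₀ ht0, mul_one, τ.symm_apply_apply, ht] at h4
    rw [h4]
    exact le_add_of_nonneg_left h3
  refine le_antisymm (by simpa using key σ.symm) ?_
  obtain ⟨a, ha⟩ := w.exists_int ((map_ne_zero σ).2 ht0)
  have h1 := map_uniformizer_pos w hK ht hN σ
  rw [ha] at h1 ⊢
  norm_cast at h1 ⊢

/-- The valuation of a totally ramified extension is invariant under automorphisms. -/
theorem map_algEquiv_eq (σ : E ≃ₐ[F] E) (x : E) : w (σ x) = w x := by
  have ht' : w t = ((1 : ℤ) : WithTop ℤ) := by simpa using ht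
  have ht0 : t ≠ 0 := by rintro rfl; simp at ht
  by_cases hx : x = 0
  · simp [hx]
  have key : ∀ (τ : E ≃ₐ[F] E) {y : E}, y ≠ 0 → w y ≤ w (τ y) := fun τ y hy => by
    obtain ⟨a, ha⟩ := w.exists_int hy
    have hz : ∀ {s : E}, w s = ((1 : ℤ) : WithTop ℤ) → w (s ^ a) = (a : WithTop ℤ) := fun {s} hs => by
      have hs0 : s ≠ 0 := by rintro rfl; simp at hs
      obtain ⟨n, rfl | rfl⟩ := a.eq_nat_or_neg
      · simpa using w.map_pow_of_eq hs n
      · obtain ⟨d, hd⟩ := w.exists_int (zpow_ne_zero (-(n : ℤ)) hs0)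
        have h := w.map_mul (s ^ (-(n : ℤ))) (s ^ n)
        rw [← zpow_natCast s n, ← zpow_add₀ hs0, neg_add_cancel, zpow_zero, w.map_one, hd,
          zpow_natCast, w.map_pow_of_eq hs] at h
        rw [hd]
        norm_cast at h ⊢
        omega
    obtain ⟨u, rfl⟩ : ∃ u, y = u * t ^ a :=
      ⟨y * (t ^ a)⁻¹, by rw [mul_assoc, inv_mul_cancel₀ (zpow_ne_zero _ ht0), mul_one]⟩
    have hu : 0 ≤ w u := by
      obtain ⟨d, hd⟩ := w.exists_int (left_ne_zero_of_mul hy)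
      rw [w.map_mul, hz ht', hd] at ha
      rw [hd]
      norm_cast at ha ⊢
      omega
    have hτ : w (τ t) = ((1 : ℤ) : WithTop ℤ) := by simpa using map_uniformizer w hK ht hN τ
    rw [ha, map_mul, w.map_mul, map_zpow₀, hz hτ]
    exact le_add_of_nonneg_left (map_nonneg_of_nonneg w hK ht hN τ hu)
  refine le_antisymm ?_ (key σ hx)
  simpa using key σ.symm ((map_ne_zero σ).2 hx)

/-- The ramification number of `σ`, read off at a uniformizer, bounds the displacement of every
integral element. -/
theorem map_sub_uniformizer_le (σ : E ≃ₐ[F] E) {x : E} (hx : 0 ≤ w x) :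
    w (σ t - t) ≤ w (σ x - x) := by
  have htn : 0 ≤ w t := by simp [ht]
  obtain ⟨c, hc, rfl⟩ := exists_eq_sum_smul_pow_of_nonneg w hK ht hN hx
  simp only [map_pow, map_sum, map_smul, ← Finset.sum_sub_distrib, ← smul_sub]
  refine w.map_le_sum fun i _ => ?_
  rw [Algebra.smul_def, w.map_mul]
  refine le_add_of_nonneg_of_le (hc i) ?_
  generalize (i : ℕ) = k
  induction k with
  | zero => simp
  | succ k ih =>
    have : σ t ^ (k + 1) - t ^ (k + 1) = (σ t ^ k - t ^ k) * t + σ t ^ k * (σ t - t) := by ring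
    rw [this]
    refine w.map_le_add ?_ ?_
    · rw [w.map_mul]
      exact le_add_of_le_of_nonneg ih htn
    · rw [w.map_mul, w.map_pow]
      exact le_add_of_nonneg_left
        (nsmul_nonneg (map_nonneg_of_nonneg w hK ht hN σ htn) k)

theorem map_sub_uniformizer_eq (σ : E ≃ₐ[F] E) {u : E} (hu : w u = 1) :
    w (σ u - u) = w (σ t - t) :=
  le_antisymm (map_sub_uniformizer_le w hK hu hN σ (by simp [ht]))
    (map_sub_uniformizer_le w hK ht hN σ (by simp [hu]))

end TotallyRamified

section Transitivity

open Polynomial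

theorem AddValuation.coeff_prod_X_sub_C_nonneg {E ι : Type*} [Field E]
    (w : AddValuation E (WithTop ℤ)) (s : Finset ι) (f : ι → E) (hf : ∀ i ∈ s, 0 ≤ w (f i))
    (k : ℕ) : 0 ≤ w ((∏ i ∈ s, (X - C (f i))).coeff k) := by
  classical
  induction s using Finset.induction_on generalizing k with
  | empty =>
    rw [Finset.prod_empty, coeff_one]
    split_ifs <;> simp
  | insert a s ha ih =>
    have ih' := ih fun i hi => hf i (Finset.mem_insert_of_mem hi)
    have ha' := hf a (Finset.mem_insert_self _ _)
    rw [Finset.prod_insert ha]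
    cases k with
    | zero =>
      rw [mul_coeff_zero, w.map_mul]
      exact add_nonneg (by simpa using ha') (ih' 0)
    | succ k =>
      rw [coeff_X_sub_C_mul]
      refine w.map_le_sub (ih' k) ?_
      rw [w.map_mul]
      exact add_nonneg ha' (ih' _)

theorem AddValuation.map_finset_prod {E ι : Type*} [Field E]
    (w : AddValuation E (WithTop ℤ)) (s : Finset ι) (f : ι → E) :
    w (∏ i ∈ s, f i) = ∑ i ∈ s, w (f i) := by
  classical
  induction s using Finset.induction_on with
  | empty => simp
  | insert a s ha ih => rw [Finset.prod_insert ha, Finset.sum_insert ha, w.map_mul, ih]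

open IntermediateField in
/-- The ramification number of an automorphism of `M^H` is the sum of the ramification numbers
of its lifts to `M`. -/
theorem sum_map_sub_uniformizer {K M : Type*} [Field K] [Field M] [Algebra K M]
    [FiniteDimensional K M] (H : Subgroup (M ≃ₐ[K] M)) [Fintype H] [Normal K (fixedField H)]
    {w : AddValuation M (WithTop ℤ)} {N : ℕ} (hN : Module.finrank K M = N)
    (hK : ∀ x : K, x ≠ 0 → ∃ a : ℤ, w (algebraMap K M x) = ((N * a : ℤ) : WithTop ℤ))
    {t : M} (ht : w t = 1)
    {w' : AddValuation (fixedField H) (WithTop ℤ)} {N' : ℕ}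
    (hN' : Module.finrank K (fixedField H) = N')
    (hK' : ∀ x : K, x ≠ 0 → ∃ a : ℤ, w' (algebraMap K _ x) = ((N' * a : ℤ) : WithTop ℤ))
    {t' : fixedField H} (ht' : w' t' = 1)
    (hcomp : ∀ x : fixedField H, w (x : M) = (Fintype.card H : WithTop ℤ) * w' x)
    (σ : M ≃ₐ[K] M) (hσ : σ.restrictNormal (fixedField H) ≠ 1) :
    ∑ τ : H, w ((σ * τ) t - t) =
      (Fintype.card H : WithTop ℤ) * w' (σ.restrictNormal (fixedField H) t' - t') := by
  classical
  set s := σ.restrictNormal (fixedField H) with hs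
  set q := Fintype.card H with hq
  set P : M[X] := ∏ τ : H, (X - C ((τ : M ≃ₐ[K] M) t)) with hP
  have hq0 : q ≠ 0 := Fintype.card_ne_zero
  have hq0' : (q : WithTop ℤ) ≠ 0 := by exact_mod_cast hq0
  have hmono : ∀ {a b : WithTop ℤ}, (q : WithTop ℤ) * a ≤ q * b ↔ a ≤ b := by
    intro a b
    have hqz : (0 : ℤ) < q := by exact_mod_cast Nat.pos_of_ne_zero hq0
    induction b using WithTop.recTopCoe with
    | top => simp [WithTop.mul_top hq0']
    | coe b =>
      induction a using WithTop.recTopCoe with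
      | top =>
        rw [WithTop.mul_top hq0']
        simp only [top_le_iff, WithTop.coe_ne_top, iff_false]
        exact_mod_cast WithTop.coe_ne_top (a := ((q : ℤ) * b))
      | coe a =>
        have : ∀ z : ℤ, (q : WithTop ℤ) * (z : WithTop ℤ) = ((q * z : ℤ) : WithTop ℤ) :=
          fun z => by push_cast; rfl
        rw [this, this, WithTop.coe_le_coe, WithTop.coe_le_coe]
        exact mul_le_mul_iff_right₀ hqz
  have hmem : ∀ k, P.coeff k ∈ fixedField H := by
    intro k
    rw [mem_fixedField_iff]
    intro ρ hρ
    have hfix : P.map (ρ : M →+* M) = P := by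
      rw [hP, Polynomial.map_prod]
      exact Fintype.prod_equiv (Equiv.mulLeft (⟨ρ, hρ⟩ : H)) _ _ fun τ => by simp
    conv_rhs => rw [← hfix]
    simp
  choose c hc using fun k => (⟨⟨P.coeff k, hmem k⟩, rfl⟩ : ∃ c : fixedField H, (c : M) = P.coeff k)
  have hsc : ∀ k, σ (c k) = s (c k) := fun k =>
    (σ.restrictNormal_commutes (fixedField H) (c k)).symm
  have hc0 : ∀ k, 0 ≤ w' (c k) := fun k => by
    rw [← hmono, ← hcomp, hc, mul_zero]
    exact w.coeff_prod_X_sub_C_nonneg _ _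
      (fun τ _ => by rw [map_uniformizer w hK ht hN]; exact zero_le_one) k
  have hc1 : w' (c 0) = 1 := by
    have h : (q : WithTop ℤ) * w' (c 0) = q * 1 := by
      rw [← hcomp, hc, hP, coeff_zero_prod, w.map_finset_prod]
      simp [map_uniformizer w hK ht hN, hq]
    exact le_antisymm (hmono.1 h.le) (hmono.1 h.ge)
  have hdeg : P.natDegree = q := by simp [hP, hq]
  have hlead : P.coeff q = 1 := by
    rw [← hdeg]
    exact monic_prod_of_monic _ _ fun τ _ => monic_X_sub_C _
  have heval : P.eval t = 0 := by
    rw [hP, eval_prod]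
    exact Finset.prod_eq_zero (Finset.mem_univ 1) (by simp)
  have hsum : ∑ k ∈ Finset.range q, ((s (c k) - c k : fixedField H) : M) * t ^ k
      = ∏ τ : H, (t - (σ * τ) t) := by
    have h1 : (P.map (σ : M →+* M)).eval t = ∏ τ : H, (t - (σ * τ) t) := by
      rw [hP, Polynomial.map_prod, eval_prod]
      simp
    rw [← h1, ← sub_zero ((P.map (σ : M →+* M)).eval t), ← heval,
      eval_eq_sum_range' (n := q + 1) (by rw [natDegree_map, hdeg]; omega),
      eval_eq_sum_range' (n := q + 1) (by rw [hdeg]; omega), Finset.sum_range_succ,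
      Finset.sum_range_succ, hlead, coeff_map, hlead, map_one, add_sub_add_right_eq_sub,
      ← Finset.sum_sub_distrib]
    refine Finset.sum_congr rfl fun k _ => ?_
    rw [← sub_mul, coeff_map, ← hc]
    simp [hsc]
  have hne : (s t' - t') ≠ 0 := by
    intro h0
    refine hσ (AlgEquiv.ext fun x => ?_)
    obtain ⟨d, hd⟩ := exists_eq_sum_smul_pow w' hK' ht' hN' x
    rw [hd]
    simp [map_sum, sub_eq_zero.1 h0]
  have hA : ((q : WithTop ℤ) * w' (s t' - t')) ≠ ⊤ := by
    rw [← hcomp, w.ne_top_iff]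
    exact_mod_cast hne
  have h0 : w ((s (c 0) - c 0 : fixedField H) : M) = q * w' (s t' - t') := by
    rw [hcomp, map_sub_uniformizer_eq w' hK' ht' hN' s hc1]
  calc ∑ τ : H, w ((σ * τ) t - t) = w (∏ τ : H, (t - (σ * τ) t)) := by
        rw [w.map_finset_prod]
        exact Finset.sum_congr rfl fun τ _ => w.map_sub_swap _ _
    _ = q * w' (s t' - t') := by
        rw [← hsum, ← Finset.add_sum_erase _ _ (Finset.mem_range.2 (Nat.pos_of_ne_zero hq0)),
          pow_zero, mul_one, w.map_add_eq_of_lt_left, h0]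
        rw [h0]
        refine w.map_lt_sum hA fun k hk => ?_
        have hk0 : k ≠ 0 := (Finset.mem_erase.1 hk).1
        have hpow : w (t ^ k) = ((k : ℤ) : WithTop ℤ) := by
          have := w.map_pow_of_eq (a := 1) (by simpa using ht) k
          simpa using this
        have hle : (q : WithTop ℤ) * w' (s t' - t') ≤ w ((s (c k) - c k : fixedField H) : M) := by
          rw [hcomp, hmono]
          exact map_sub_uniformizer_le w' hK' ht' hN' s (hc0 k)
        obtain ⟨a, ha⟩ := WithTop.ne_top_iff_exists.1 hA
        rw [w.map_mul, hpow]
        refine lt_of_lt_of_le ?_ (add_le_add_left hle _)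
        rw [← ha]
        norm_cast
        omega

end Transitivity

section Count

open Finset

variable {K E : Type*} [Field K] [Field E] [Algebra K E]

/-- The number of lower ramification groups containing `σ` is its ramification number. -/
theorem card_filter_mem_ramGroup {v : E → WithTop ℤ} {t : E} {e : ℕ}
    (he : ∀ i, e < i → ramGroup (K := K) v t i = {1}) {σ : E ≃ₐ[K] E} (hσ : σ ≠ 1)
    (h1 : 1 ≤ v (σ t - t)) [DecidablePred fun i => σ ∈ ramGroup v t i] :
    (#{i ∈ range (e + 1) | σ ∈ ramGroup v t i} : WithTop ℤ) = v (σ t - t) := by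
  have hlt : ¬ (((e + 1 : ℕ) : ℤ) + 1 : ℤ) ≤ v (σ t - t) := fun h => by
    have : σ ∈ ramGroup v t (e + 1) := h
    rw [he _ (Nat.lt_succ_self e)] at this
    exact hσ this
  have hnt : v (σ t - t) ≠ ⊤ := fun h => hlt (by rw [h]; exact le_top)
  obtain ⟨a, ha⟩ := WithTop.ne_top_iff_exists.1 hnt
  rw [← ha] at hlt h1 ⊢
  norm_cast at hlt h1
  lift a to ℕ using by omega
  have : {i ∈ range (e + 1) | σ ∈ ramGroup v t i} = range a := by
    ext i
    simp only [ramGroup, Set.mem_ofPred_eq, ← ha, WithTop.coe_le_coe, mem_filter, mem_range]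
    omega
  rw [this, card_range]
  norm_cast

theorem sum_ncard_ramGroup [FiniteDimensional K E] (v : E → WithTop ℤ) (t : E) (e : ℕ)
    [∀ i, DecidablePred fun σ => σ ∈ ramGroup (K := K) v t i] :
    ∑ i ∈ range (e + 1), (ramGroup (K := K) v t i).ncard =
      ∑ σ : E ≃ₐ[K] E, #{i ∈ range (e + 1) | σ ∈ ramGroup v t i} := by
  refine Eq.trans (sum_congr rfl fun i _ => ?_)
    (sum_card_bipartiteAbove_eq_sum_card_bipartiteBelow (fun i σ => σ ∈ ramGroup v t i))
  rw [bipartiteAbove, ← Set.ncard_coe_finset]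
  simp

theorem one_mem_ramGroup {v : E → WithTop ℤ} (hv : IsAddValuation v) (t : E) (i : ℕ) :
    (1 : E ≃ₐ[K] E) ∈ ramGroup v t i := by
  simp [ramGroup, (hv.1 0).2 rfl]

theorem sum_ncard_ramGroup_sub_one [FiniteDimensional K E] {v : E → WithTop ℤ}
    (hv : IsAddValuation v) (t : E) (e : ℕ) [DecidableEq (E ≃ₐ[K] E)]
    [∀ i, DecidablePred fun σ => σ ∈ ramGroup (K := K) v t i] :
    ∑ i ∈ range (e + 1), ((ramGroup (K := K) v t i).ncard - 1) =
      ∑ σ ∈ univ.erase (1 : E ≃ₐ[K] E), #{i ∈ range (e + 1) | σ ∈ ramGroup v t i} := by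
  have h := sum_ncard_ramGroup (K := K) v t e
  rw [← add_sum_erase _ _ (mem_univ 1)] at h
  have h1 : ∑ i ∈ range (e + 1), (ramGroup (K := K) v t i).ncard =
      ∑ i ∈ range (e + 1), ((ramGroup (K := K) v t i).ncard - 1) + (e + 1) := by
    have : ∑ i ∈ range (e + 1), 1 = e + 1 := by simp
    refine Eq.trans ?_ (congrArg (_ + ·) this)
    rw [← sum_add_distrib]
    refine sum_congr rfl fun i _ => ?_
    have : 0 < (ramGroup (K := K) v t i).ncard :=
      (Set.ncard_pos (Set.toFinite _)).2 ⟨1, one_mem_ramGroup hv t i⟩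
    omega
  simp only [one_mem_ramGroup hv, filter_true, card_range] at h
  omega

end Count

section Herbrand

open Finset

/-- In a totally ramified extension the lower ramification groups are closed under powers. -/
theorem pow_mem_ramGroup {K M : Type*} [Field K] [Field M] [Algebra K M] [FiniteDimensional K M]
    (w : AddValuation M (WithTop ℤ)) {N : ℕ} (hN : Module.finrank K M = N)
    (hK : ∀ x : K, x ≠ 0 → ∃ a : ℤ, w (algebraMap K M x) = ((N * a : ℤ) : WithTop ℤ))
    {t : M} (ht : w t = 1) {i : ℕ} {σ : M ≃ₐ[K] M} (hσ : σ ∈ ramGroup w t i) (k : ℕ) :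
    σ ^ k ∈ ramGroup w t i := by
  induction k with
  | zero => simp [ramGroup]
  | succ k ih =>
    have h : (σ ^ (k + 1)) t - t = σ ((σ ^ k) t - t) + (σ t - t) := by
      rw [pow_succ', map_sub, AlgEquiv.mul_apply]
      ring
    change _ ≤ w _
    rw [h]
    refine w.map_le_add ?_ hσ
    rw [map_algEquiv_eq w hK ht hN]
    exact ih

open IntermediateField in
theorem restrictNormalHom_fixedField_eq_one_iff {K M : Type*} [Field K] [Field M] [Algebra K M]
    [FiniteDimensional K M] (H : Subgroup (M ≃ₐ[K] M)) [Normal K (fixedField H)]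
    (σ : M ≃ₐ[K] M) : AlgEquiv.restrictNormalHom (fixedField H) σ = 1 ↔ σ ∈ H := by
  rw [← MonoidHom.mem_ker, restrictNormalHom_ker, fixingSubgroup_fixedField]

open IntermediateField in
/-- Transitivity of the different for the tower `K ⊆ M^H ⊆ M`, in terms of the numbers
`iM σ` and `iL s` of lower ramification groups containing an automorphism, when `iM` is constant
on `H`. -/
theorem sum_eq_of_sum_fiber {K M : Type*} [Field K] [Field M] [Algebra K M]
    [IsGalois K M] [FiniteDimensional K M] [DecidableEq (M ≃ₐ[K] M)]
    (H : Subgroup (M ≃ₐ[K] M)) [Fintype H] [Normal K (fixedField H)]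
    [DecidableEq (fixedField H ≃ₐ[K] fixedField H)]
    (iM : (M ≃ₐ[K] M) → ℕ) (iL : (fixedField H ≃ₐ[K] fixedField H) → ℕ) (e : ℕ)
    (h1 : ∀ τ ∈ H, iM τ = e)
    (h2 : ∀ σ : M ≃ₐ[K] M, σ.restrictNormal (fixedField H) ≠ 1 →
      ∑ τ : H, iM (σ * τ) = Fintype.card H * iL (σ.restrictNormal (fixedField H))) :
    ∑ σ, iM σ = Fintype.card H * (e + ∑ s ∈ univ.erase 1, iL s) := by
  have hfib : ∀ σ : M ≃ₐ[K] M,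
      ∑ ρ with AlgEquiv.restrictNormalHom (fixedField H) ρ =
        AlgEquiv.restrictNormalHom (fixedField H) σ, iM ρ = ∑ τ : H, iM (σ * τ) := by
    intro σ
    symm
    refine sum_bij (fun τ _ => σ * τ) (fun τ _ => ?_) (fun a _ b _ hab => ?_) (fun ρ hρ => ?_)
      (fun _ _ => rfl)
    · rw [mem_filter, map_mul, (restrictNormalHom_fixedField_eq_one_iff H _).2 τ.2, mul_one]
      exact ⟨mem_univ _, rfl⟩
    · exact Subtype.ext (mul_left_cancel hab)
    · refine ⟨⟨σ⁻¹ * ρ, (restrictNormalHom_fixedField_eq_one_iff H _).1 ?_⟩, mem_univ _, by simp⟩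
      rw [map_mul, map_inv, (mem_filter.1 hρ).2, inv_mul_cancel]
  rw [← sum_fiberwise univ (AlgEquiv.restrictNormalHom (fixedField H)) iM,
    ← add_sum_erase _ _ (mem_univ 1), mul_add, mul_sum]
  congr 1
  · rw [← map_one (AlgEquiv.restrictNormalHom (fixedField H) : (M ≃ₐ[K] M) →* _), hfib,
      sum_congr rfl fun τ _ => h1 _ (by simp)]
    simp
  · refine sum_congr rfl fun s hs => ?_
    obtain ⟨σ, rfl⟩ :=
      AlgEquiv.restrictNormalHom_surjective (F := K) (K₁ := fixedField H) (E := M) s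
    rw [hfib]
    exact h2 σ (mem_erase.1 hs).1

end Herbrand

/-- Let `K` be a complete discretely valued field with perfect residue field of
characteristic `p > 0`, `M/K` finite Galois totally ramified with group `G̃`, `H ⊆ G̃` normal
of order `p` with `G̃/H` of order `p^n`, and `L = M^H`, so `L/K` is Galois totally ramified of
degree `p^n`. Let `e(M/K)` be the largest integer with `G̃_{e(M/K)} ≠ {1}` and suppose
`G̃_{e(M/K)} ∩ H ≠ {1}`. Let `m(M/K)` be the conductor exponent of `M/K` and
`μ(L/K) = deg𝔇_{L/K} − p^n + 1`. Then `e(M/K) = p^n·m(M/K) − μ(L/K)`. -/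
theorem e_eq_pn_m_sub_mu (p n : ℕ) [Fact p.Prime] (K M : Type*) [Field K] [Field M]
    [Algebra K M] [IsGalois K M] [FiniteDimensional K M]
    (H : Subgroup (M ≃ₐ[K] M)) [H.Normal] (hH : Nat.card H = p)
    (hdeg : Module.finrank K M = p ^ (n + 1))
    [IsGalois K ↥(IntermediateField.fixedField H)]
    (hdegL : Module.finrank K ↥(IntermediateField.fixedField H) = p ^ n)
    -- the normalized valuation of `M` and a uniformizer
    (vM : M → WithTop ℤ) (hvM : IsAddValuation vM) (tM : M) (htM : vM tM = 1)
    -- `K` is complete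
    (hcompl : ∀ x : ℕ → K,
      (∀ c : ℤ, ∃ N : ℕ, ∀ i ≥ N, ∀ j ≥ N, (c : WithTop ℤ) ≤ vM (algebraMap K M (x i - x j))) →
      ∃ a : K, ∀ c : ℤ, ∃ N : ℕ, ∀ i ≥ N, (c : WithTop ℤ) ≤ vM (algebraMap K M (x i - a)))
    -- the residue characteristic is `p` and the residue field is perfect
    (hresp : (0 : WithTop ℤ) < vM (p : M))
    (hperf : ∀ x : M, 0 ≤ vM x → ∃ z : M, 0 < vM (x - z ^ p))
    -- `M/K` is totally ramified of degree `p^(n+1)`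
    (htr : ∀ x : K, x ≠ 0 → ∃ a : ℤ, vM (algebraMap K M x) = ((p ^ (n + 1) * a : ℤ) : WithTop ℤ))
    -- the normalized valuation of `L = M^H` and a uniformizer, compatible with `vM`
    (vL : ↥(IntermediateField.fixedField H) → WithTop ℤ) (hvL : IsAddValuation vL)
    (tL : ↥(IntermediateField.fixedField H)) (htL : vL tL = 1)
    (hcomp : ∀ x : ↥(IntermediateField.fixedField H), vM (x : M) = p * vL x)
    -- `e(M/K)` is the largest integer with `G̃_e ≠ {1}`
    (eM : ℕ) (heM : ramGroup (K := K) vM tM eM ≠ {1})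
    (heM' : ∀ i, eM < i → ramGroup (K := K) vM tM i = {1})
    -- the hypothesis `G̃_{e(M/K)} ∩ H ≠ {1}`
    (hHe : ∃ σ : M ≃ₐ[K] M, σ ∈ H ∧ σ ∈ ramGroup (K := K) vM tM eM ∧ σ ≠ 1)
    -- the conductor exponent of `M/K`
    (mM : ℚ)
    (hmM : mM = (∑ i ∈ Finset.range (eM + 1), ((ramGroup (K := K) vM tM i).ncard : ℚ))
        / p ^ (n + 1) - 1)
    -- `e(L/K)` and the degree of the different of `L/K` (Hilbert's formula)
    (eL : ℕ) (heL : ramGroup (K := K) vL tL eL ≠ {1})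
    (heL' : ∀ i, eL < i → ramGroup (K := K) vL tL i = {1})
    (dL : ℕ) (hdL : dL = ∑ i ∈ Finset.range (eL + 1), ((ramGroup (K := K) vL tL i).ncard - 1))
    (μL : ℤ) (hμL : μL = (dL : ℤ) - p ^ n + 1) :
    (eM : ℚ) = p ^ n * mM - μL := by
  classical
  have hp : p.Prime := Fact.out
  obtain ⟨w, hw⟩ := hvM.exists_addValuation
  obtain rfl : vM = w := funext hw
  obtain ⟨w', hw'⟩ := hvL.exists_addValuation
  obtain rfl : vL = w' := funext hw'
  have hcard : Fintype.card H = p := by rw [← Nat.card_eq_fintype_card, hH]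
  have hK : ∀ x : K, x ≠ 0 →
      ∃ a : ℤ, w (algebraMap K M x) = (((p ^ (n + 1) : ℕ) * a : ℤ) : WithTop ℤ) := fun x hx => by
    obtain ⟨a, ha⟩ := htr x hx
    exact ⟨a, by rw [ha]; push_cast; rfl⟩
  have hK' : ∀ x : K, x ≠ 0 → ∃ a : ℤ,
      w' (algebraMap K _ x) = (((p ^ n : ℕ) * a : ℤ) : WithTop ℤ) := fun x hx => by
    obtain ⟨a, ha⟩ := htr x hx
    refine ⟨a, ?_⟩
    obtain ⟨b, hb⟩ := w'.exists_int ((map_ne_zero (algebraMap K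
      ↥(IntermediateField.fixedField H))).2 hx)
    have h := hcomp (algebraMap K _ x)
    rw [hb, ← IntermediateField.algebraMap_apply, ← IsScalarTower.algebraMap_apply, ha] at h
    have h2 : (p ^ (n + 1) * a : ℤ) = p * b := by
      rw [← WithTop.coe_inj, h]
      push_cast
      rfl
    rw [hb, WithTop.coe_inj]
    refine mul_left_cancel₀ (a := (p : ℤ)) (by exact_mod_cast hp.ne_zero) ?_
    rw [← h2]
    push_cast
    ring
  have hcomp' : ∀ x : IntermediateField.fixedField H,
      w (x : M) = (Fintype.card H : WithTop ℤ) * w' x := by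
    rw [hcard]
    exact hcomp
  have hHmem : ∀ τ ∈ H, τ ∈ ramGroup (K := K) w tM eM := by
    obtain ⟨σ, hσH, hσ, hσ1⟩ := hHe
    intro τ hτ
    obtain ⟨k, hk⟩ := mem_powers_of_prime_card (p := p) hH (g := (⟨σ, hσH⟩ : H))
      (g' := ⟨τ, hτ⟩) (fun h => hσ1 (congrArg Subtype.val h))
    have hk' : σ ^ k = τ := congrArg Subtype.val hk
    rw [← hk']
    exact pow_mem_ramGroup w hdeg hK htM hσ k
  have hwt : ∀ σ : M ≃ₐ[K] M, 1 ≤ w (σ tM - tM) := fun σ =>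
    w.map_le_sub (map_uniformizer w hK htM hdeg σ).ge htM.ge
  have hwt' : ∀ s : IntermediateField.fixedField H ≃ₐ[K] IntermediateField.fixedField H,
      1 ≤ w' (s tL - tL) := fun s =>
    w'.map_le_sub (map_uniformizer w' hK' htL hdegL s).ge htL.ge
  have key := sum_eq_of_sum_fiber H
    (fun σ => ((Finset.range (eM + 1)).filter fun i => σ ∈ ramGroup (K := K) w tM i).card)
    (fun s => ((Finset.range (eL + 1)).filter fun i => s ∈ ramGroup (K := K) w' tL i).card) (eM + 1)
    (fun τ hτ => by
      rw [Finset.filter_true_of_mem, Finset.card_range]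
      intro i hi
      refine le_trans (b := (((eM : ℤ) + 1 : ℤ) : WithTop ℤ)) ?_ (hHmem τ hτ)
      rw [WithTop.coe_le_coe]
      have := Finset.mem_range.1 hi
      omega)
    (fun σ hσ => by
      have h := sum_map_sub_uniformizer H hdeg hK htM hdegL hK' htL hcomp' σ hσ
      rw [← card_filter_mem_ramGroup heL' hσ (hwt' _)] at h
      have hne : ∀ τ : H, σ * τ ≠ 1 := fun τ h1 => hσ <|
        (restrictNormalHom_fixedField_eq_one_iff H σ).2 <| by
          rw [eq_inv_of_mul_eq_one_left h1]
          exact H.inv_mem τ.2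
      rw [Finset.sum_congr rfl fun (τ : H) _ =>
        (card_filter_mem_ramGroup heM' (hne τ) (hwt (σ * τ))).symm] at h
      rw [← Nat.cast_sum] at h
      have h' : ∀ a b c : ℕ, (a : WithTop ℤ) = b * c → a = b * c := fun a b c h => by
        rw [← WithTop.coe_natCast, ← WithTop.coe_natCast, ← WithTop.coe_natCast,
          ← WithTop.coe_mul, WithTop.coe_inj] at h
        exact_mod_cast h
      exact h' _ _ _ h)
  rw [← sum_ncard_ramGroup, ← sum_ncard_ramGroup_sub_one hvL, ← hdL, hcard] at key
  have hp0 : (p : ℚ) ≠ 0 := by exact_mod_cast hp.ne_zero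
  have key' : ∑ i ∈ Finset.range (eM + 1), ((ramGroup (K := K) w tM i).ncard : ℚ) =
      p * ((eM + 1) + dL) := by exact_mod_cast key
  rw [hmM, hμL, key']
  push_cast
  field_simp
  ring
end

section
/- Let p be a prime, n ≥ 1, and 0 ≤ i ≤ n−1. Then the polynomial c_n + X_i^{p^{n−i}−1}·(Y_i + c_i) ∈ ℤ[X_0,…,X_{n−1},Y_0,…,Y_{n−1}] has degree in the variable X_i strictly smaller than p^{n−i} − 1. Moreover c_n is isobaric of weight p^n for the grading in which X_j and Y_j have weight p^j. -/
open MvPolynomial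

/-- The Witt addition polynomials `S_j`, characterized by
`Φ_j(S_0,…,S_j) = Φ_j(X_0,…,X_j) + Φ_j(Y_0,…,Y_j)`; in Mathlib these are `WittVector.wittAdd`,
with `X_i` the variable `(0, i)` and `Y_i` the variable `(1, i)`. -/
noncomputable def wittS (p : ℕ) [Fact p.Prime] (j : ℕ) : MvPolynomial (Fin 2 × ℕ) ℤ :=
  WittVector.wittAdd p j

/-- The carry polynomials `c_j = S_j − X_j − Y_j`. -/
noncomputable def wittC (p : ℕ) [Fact p.Prime] (j : ℕ) : MvPolynomial (Fin 2 × ℕ) ℤ :=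
  wittS p j - X (0, j) - X (1, j)

namespace MvPolynomial

/-- The degree of a finite sum in one variable is bounded if those of its terms are. -/
theorem degreeOf_sum_lt {σ R ι : Type*} [CommSemiring R] {v : σ} {d : ℕ} (hd : 0 < d)
    (s : Finset ι) (f : ι → MvPolynomial σ R) (h : ∀ j ∈ s, degreeOf v (f j) < d) :
    degreeOf v (∑ j ∈ s, f j) < d :=
  (degreeOf_sum_le v s f).trans_lt ((Finset.sup_lt_iff hd).2 h)

theorem degreeOf_add_lt {σ R : Type*} [CommSemiring R] {v : σ} {d : ℕ}
    {f g : MvPolynomial σ R} (hf : degreeOf v f < d) (hg : degreeOf v g < d) :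
    degreeOf v (f + g) < d :=
  (degreeOf_add_le v f g).trans_lt (max_lt hf hg)

theorem degreeOf_natCast_mul_eq {σ : Type*} (v : σ) {a : ℕ} (ha : a ≠ 0)
    (f : MvPolynomial σ ℤ) : degreeOf v ((a : MvPolynomial σ ℤ) * f) = degreeOf v f := by
  have := degreeOf_C_mul (p := f) v (a : ℤ)
    (mem_nonZeroDivisors_of_ne_zero (by exact_mod_cast ha))
  simpa using this

theorem IsWeightedHomogeneous.of_natCast_mul {σ : Type*} {w : σ → ℕ} {d a : ℕ} (ha : a ≠ 0)
    {f : MvPolynomial σ ℤ}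
    (h : IsWeightedHomogeneous w ((a : MvPolynomial σ ℤ) * f) d) :
    IsWeightedHomogeneous w f d := by
  intro m hm
  apply h
  rw [← map_natCast (C : ℤ →+* MvPolynomial σ ℤ), coeff_C_mul]
  exact mul_ne_zero (by exact_mod_cast ha) hm

theorem IsWeightedHomogeneous.natCast_mul {σ : Type*} {w : σ → ℕ} {d : ℕ} (a : ℕ)
    {f : MvPolynomial σ ℤ} (h : IsWeightedHomogeneous w f d) :
    IsWeightedHomogeneous w ((a : MvPolynomial σ ℤ) * f) d := by
  have := (isWeightedHomogeneous_C w (a : ℤ)).mul h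
  simpa using this

/-- The binomial expansion of `(X v + T) ^ N` up to terms of degree `< N - 1` in `X v`. -/
theorem degreeOf_X_add_pow_sub_lt {σ : Type*} (v : σ) {T : MvPolynomial σ ℤ}
    (hT : degreeOf v T = 0) {N : ℕ} (hN : 2 ≤ N) :
    degreeOf v (X v ^ N - (X v + T) ^ N + (N : MvPolynomial σ ℤ) * (X v ^ (N - 1) * T)) <
      N - 1 := by
  obtain ⟨M, rfl⟩ := Nat.exists_eq_add_of_le' hN
  have key : X v ^ (M + 2) - (X v + T) ^ (M + 2) +
      ((M + 2 : ℕ) : MvPolynomial σ ℤ) * (X v ^ (M + 2 - 1) * T) =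
      - ∑ k ∈ Finset.range (M + 1),
        ((M + 2).choose k : MvPolynomial σ ℤ) * (X v ^ k * T ^ (M + 2 - k)) := by
    rw [add_pow, Finset.sum_range_succ, Finset.sum_range_succ]
    have h1 : M + 2 - (M + 1) = 1 := by omega
    have h2 : (M + 2).choose (M + 1) = M + 2 := Nat.choose_succ_self_right (M + 1)
    rw [h1, h2]
    have h3 : ∀ k, ((M + 2).choose k : MvPolynomial σ ℤ) * (X v ^ k * T ^ (M + 2 - k)) =
      X v ^ k * T ^ (M + 2 - k) * ((M + 2).choose k : MvPolynomial σ ℤ) := fun k => by ring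
    simp only [h3]
    simp
    ring
  rw [key, degreeOf_neg]
  refine degreeOf_sum_lt (by omega) _ _ fun k hk => ?_
  rw [Finset.mem_range] at hk
  rw [degreeOf_natCast_mul_eq v (Nat.choose_pos (by omega)).ne']
  have hX : degreeOf v (X v ^ k : MvPolynomial σ ℤ) = k :=
    degreeOf_X_self_pow v k
  have hTk : degreeOf v (T ^ (M + 2 - k)) ≤ (M + 2 - k) * degreeOf v T := degreeOf_pow_le ..
  have := degreeOf_mul_le v (X v ^ k) (T ^ (M + 2 - k))
  rw [hT, mul_zero] at hTk
  omega

end MvPolynomial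

section

variable (p : ℕ) [Fact p.Prime]

theorem wittS_eq (n : ℕ) : wittS p n = X (0, n) + X (1, n) + wittC p n := by
  rw [wittC]; ring

/-- The recursion for the carry polynomials given by the ghost equation. -/
theorem pow_mul_wittC (n : ℕ) :
    ((p ^ n : ℕ) : MvPolynomial (Fin 2 × ℕ) ℤ) * wittC p n =
      ∑ h ∈ Finset.range n, ((p ^ h : ℕ) : MvPolynomial (Fin 2 × ℕ) ℤ) *
        (X (0, h) ^ p ^ (n - h) + X (1, h) ^ p ^ (n - h) - wittS p h ^ p ^ (n - h)) := by
  have H := wittStructureInt_prop p (X 0 + X 1 : MvPolynomial (Fin 2) ℤ) n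
  rw [wittPolynomial_eq_sum_C_mul_X_pow] at H
  simp only [map_sum, map_mul, map_pow, map_add, bind₁_X_right, rename_X, map_natCast,
    Finset.sum_range_succ, Nat.sub_self, pow_zero, pow_one] at H
  have hS : ∀ h, wittStructureInt p (X 0 + X 1 : MvPolynomial (Fin 2) ℤ) h = wittS p h :=
    fun _ => rfl
  simp only [hS] at H
  simp only [mul_add, mul_sub, Finset.sum_add_distrib, Finset.sum_sub_distrib, wittC]
  push_cast
  linear_combination H

theorem isWeightedHomogeneous_wittC (n : ℕ) :
    IsWeightedHomogeneous (fun v : Fin 2 × ℕ => p ^ v.2) (wittC p n) (p ^ n) := by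
  induction n using Nat.strong_induction_on with
  | _ n ih =>
    refine .of_natCast_mul (pow_ne_zero n (Fact.out : p.Prime).ne_zero) (?_ :
      IsWeightedHomogeneous _ (((p ^ n : ℕ) : MvPolynomial (Fin 2 × ℕ) ℤ) * wittC p n) _)
    rw [pow_mul_wittC]
    refine .sum _ _ _ fun h hh => .natCast_mul _ ?_
    rw [Finset.mem_range] at hh
    have hX (a : Fin 2) : IsWeightedHomogeneous (fun v : Fin 2 × ℕ => p ^ v.2)
        (X (a, h) : MvPolynomial (Fin 2 × ℕ) ℤ) (p ^ h) := isWeightedHomogeneous_X ..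
    have hpow {f : MvPolynomial (Fin 2 × ℕ) ℤ}
        (hf : IsWeightedHomogeneous (fun v : Fin 2 × ℕ => p ^ v.2) f (p ^ h)) :
        IsWeightedHomogeneous (fun v : Fin 2 × ℕ => p ^ v.2) (f ^ p ^ (n - h)) (p ^ n) := by
      have := hf.pow (p ^ (n - h))
      rwa [smul_eq_mul, ← pow_add, Nat.sub_add_cancel hh.le] at this
    have hS : IsWeightedHomogeneous (fun v : Fin 2 × ℕ => p ^ v.2) (wittS p h) (p ^ h) := by
      rw [wittS_eq]
      exact ((hX 0).add (hX 1)).add (ih h hh)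
    exact ((hpow (hX 0)).add (hpow (hX 1))).sub (hpow hS)

theorem degreeOf_wittC_eq_zero (a : Fin 2) {n i : ℕ} (hni : n ≤ i) :
    degreeOf (a, i) (wittC p n) = 0 := by
  induction n using Nat.strong_induction_on with
  | _ n ih =>
    rw [← degreeOf_natCast_mul_eq _ (pow_ne_zero n (Fact.out : p.Prime).ne_zero), pow_mul_wittC,
      ← Nat.lt_one_iff]
    refine degreeOf_sum_lt one_pos _ _ fun h hh => ?_
    rw [Finset.mem_range] at hh
    rw [degreeOf_natCast_mul_eq _ (pow_ne_zero h (Fact.out : p.Prime).ne_zero)]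
    have hX (b : Fin 2) : degreeOf (a, i) (X (b, h) : MvPolynomial (Fin 2 × ℕ) ℤ) = 0 :=
      degreeOf_X_of_ne (by simp; omega)
    have hpow {f : MvPolynomial (Fin 2 × ℕ) ℤ} (hf : degreeOf (a, i) f = 0) (N : ℕ) :
        degreeOf (a, i) (f ^ N) < 1 :=
      Nat.lt_one_iff.2 (Nat.le_zero.1 ((degreeOf_pow_le ..).trans (by rw [hf, mul_zero])))
    have hS : degreeOf (a, i) (wittS p h) = 0 := by
      rw [wittS_eq, ← Nat.lt_one_iff]
      refine degreeOf_add_lt (degreeOf_add_lt ?_ ?_) ?_ <;>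
        simp [hX, ih h hh (hh.le.trans hni)]
    exact (degreeOf_sub_le ..).trans_lt
      (max_lt (degreeOf_add_lt (hpow (hX 0) _) (hpow (hX 1) _)) (hpow hS _))

theorem degreeOf_wittC_add_lt {n i : ℕ} (hi : i < n) :
    degreeOf ((0 : Fin 2), i)
        (wittC p n + X (0, i) ^ (p ^ (n - i) - 1) * (X (1, i) + wittC p i)) <
      p ^ (n - i) - 1 := by
  induction n using Nat.strong_induction_on with
  | _ n ih =>
    have hp : p.Prime := Fact.out
    have hlt {k : ℕ} (hk : k ≠ 0) : 1 < p ^ k := Nat.one_lt_pow hk hp.one_lt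
    have hN : 2 ≤ p ^ (n - i) := hlt (by omega)
    have hd : 0 < p ^ (n - i) - 1 := by omega
    set v : Fin 2 × ℕ := (0, i) with hv
    set T : MvPolynomial (Fin 2 × ℕ) ℤ := X (1, i) + wittC p i with hT_def
    have hT : degreeOf v T = 0 := by
      rw [← Nat.lt_one_iff]
      refine degreeOf_add_lt ?_ ?_
      · rw [degreeOf_X_of_ne (by simp [hv])]; exact one_pos
      · rw [degreeOf_wittC_eq_zero p 0 le_rfl]; exact one_pos
    have hpow {f : MvPolynomial (Fin 2 × ℕ) ℤ} (hf : degreeOf v f = 0) (N : ℕ) :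
        degreeOf v (f ^ N) < p ^ (n - i) - 1 :=
      ((degreeOf_pow_le ..).trans (by rw [hf, mul_zero])).trans_lt hd
    have key : ((p ^ n : ℕ) : MvPolynomial (Fin 2 × ℕ) ℤ) *
          (wittC p n + X v ^ (p ^ (n - i) - 1) * T) =
        ((p ^ i : ℕ) : MvPolynomial (Fin 2 × ℕ) ℤ) *
          ((X v ^ p ^ (n - i) - (X v + T) ^ p ^ (n - i) +
            ((p ^ (n - i) : ℕ) : MvPolynomial (Fin 2 × ℕ) ℤ) * (X v ^ (p ^ (n - i) - 1) * T)) +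
            X (1, i) ^ p ^ (n - i)) +
        ∑ h ∈ (Finset.range n).erase i, ((p ^ h : ℕ) : MvPolynomial (Fin 2 × ℕ) ℤ) *
          (X (0, h) ^ p ^ (n - h) + X (1, h) ^ p ^ (n - h) - wittS p h ^ p ^ (n - h)) := by
      have hpn : p ^ n = p ^ i * p ^ (n - i) := by rw [← pow_add]; congr 1; omega
      have hS : wittS p i = X v + T := by rw [wittS_eq, hT_def]; ring
      rw [mul_add, pow_mul_wittC, ← Finset.add_sum_erase _ _ (Finset.mem_range.2 hi), hS, hpn,
        Nat.cast_mul]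
      ring
    rw [← degreeOf_natCast_mul_eq v (pow_ne_zero n hp.ne_zero), key]
    refine degreeOf_add_lt ?_ (degreeOf_sum_lt hd _ _ fun h hh => ?_)
    · rw [degreeOf_natCast_mul_eq v (pow_ne_zero i hp.ne_zero)]
      exact degreeOf_add_lt (degreeOf_X_add_pow_sub_lt v hT hN)
        (hpow (degreeOf_X_of_ne (by simp [hv])) _)
    · rw [Finset.mem_erase, Finset.mem_range] at hh
      obtain ⟨hne, hhn⟩ := hh
      rw [degreeOf_natCast_mul_eq v (pow_ne_zero h hp.ne_zero)]
      have hX (b : Fin 2) : degreeOf v (X (b, h) : MvPolynomial (Fin 2 × ℕ) ℤ) = 0 :=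
        degreeOf_X_of_ne (by simp [hv, hne.symm])
      have hC : degreeOf v (wittC p h) < p ^ (h - i) := by
        rcases hne.lt_or_gt with hlt' | hgt
        · rw [degreeOf_wittC_eq_zero p 0 hlt'.le]; exact pow_pos hp.pos _
        · have h1 := ih h hhn hgt
          have h2 : degreeOf v (X v ^ (p ^ (h - i) - 1) * T) ≤ p ^ (h - i) - 1 := by
            refine (degreeOf_mul_le ..).trans ?_
            rw [degreeOf_X_self_pow, hT, add_zero]
          rw [← add_sub_cancel_right (wittC p h) (X v ^ (p ^ (h - i) - 1) * T)]
          have h3 : 0 < p ^ (h - i) := pow_pos hp.pos _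
          exact (degreeOf_sub_le ..).trans_lt (max_lt (by omega) (by omega))
      have hS : degreeOf v (wittS p h) < p ^ (h - i) := by
        have h3 : 0 < p ^ (h - i) := pow_pos hp.pos _
        rw [wittS_eq]
        exact degreeOf_add_lt (degreeOf_add_lt (by rwa [hX]) (by rwa [hX])) hC
      have hSpow : degreeOf v (wittS p h ^ p ^ (n - h)) < p ^ (n - i) - 1 := by
        refine (degreeOf_pow_le ..).trans_lt ?_
        rcases hne.lt_or_gt with hlt' | hgt
        · rw [Nat.sub_eq_zero_of_le hlt'.le, pow_zero, Nat.lt_one_iff] at hS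
          rwa [hS, mul_zero]
        · have h1 := Nat.mul_le_mul_left (p ^ (n - h)) (Nat.succ_le_of_lt hS)
          have h2 : p ^ (n - h) * p ^ (h - i) = p ^ (n - i) := by
            rw [← pow_add]; congr 1; omega
          have h3 := hlt (show n - h ≠ 0 by omega)
          rw [h2, Nat.succ_eq_add_one, mul_add, mul_one] at h1
          omega
      exact (degreeOf_sub_le ..).trans_lt
        (max_lt (degreeOf_add_lt (hpow (hX 0) _) (hpow (hX 1) _)) hSpow)

end

/-- for a prime `p`, `n ≥ 1` and `0 ≤ i ≤ n−1`, the polynomial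
`R_{i,n} = c_n + X_i^{p^{n−i}−1}·(Y_i + c_i)` has degree in the variable `X_i` strictly
smaller than `p^{n−i} − 1`; moreover `c_n` is isobaric of weight `p^n` for the grading in
which `X_j` and `Y_j` have weight `p^j`. -/
theorem wittC_decomposition (p : ℕ) [Fact p.Prime] (n : ℕ) (hn : 1 ≤ n) (i : ℕ) (hi : i ≤ n - 1) :
    degreeOf ((0 : Fin 2), i)
        (wittC p n + X (0, i) ^ (p ^ (n - i) - 1) * (X (1, i) + wittC p i)) <
      p ^ (n - i) - 1 ∧
    IsWeightedHomogeneous (fun v : Fin 2 × ℕ => p ^ v.2) (wittC p n) (p ^ n) := by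
  exact ⟨degreeOf_wittC_add_lt p (by omega), isWeightedHomogeneous_wittC p n⟩
end

section
/- In the Artin–Schreier–Witt tower setting of length n+1 (with n ≥ 1), let z = u_n + y_n − y_n^p; then z lies in L_n, and its normalized valuation satisfies v_{L_n}(z) ≥ −(p^{n+1} − p + 1)·m_n, where m_n = max_{0≤i≤n−1} p^{n−1−i} ν_i. -/
set_option synthInstance.maxHeartbeats 1000000
set_option maxHeartbeats 1600000

/-- The Frobenius on truncated Witt vectors over a ring of characteristic `p`: it raises
each component to the `p`-th power. -/
noncomputable def twFrobenius (p m : ℕ) {R : Type*} [CommRing R]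
    (x : TruncatedWittVector p m R) : TruncatedWittVector p m R :=
  TruncatedWittVector.mk p fun i => x.coeff i ^ p

/-- Componentwise application of a ring homomorphism to a truncated Witt vector. -/
noncomputable def twMap (p m : ℕ) {R S : Type*} [CommRing R] [CommRing S]
    (f : R →+* S) (x : TruncatedWittVector p m R) : TruncatedWittVector p m S :=
  TruncatedWittVector.mk p fun i => f (x.coeff i)

namespace WittVector

theorem init_congr {p : ℕ} {R : Type*} [CommRing R] {x y : WittVector p R} {n : ℕ} (h : ∀ i < n, x.coeff i = y.coeff i) :
    init n x = init n y := by
  ext i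
  by_cases hi : i < n <;> simp [init, select, hi, h]

section Carry

variable {p : ℕ} [hp : Fact p.Prime] {R S : Type*} [CommRing R] [CommRing S]

theorem coeff_teichmuller_mul (r : R) (x : WittVector p R) (n : ℕ) :
    (teichmuller p r * x).coeff n = r ^ p ^ n * x.coeff n := by
  have map_mk {B C : Type _} [CommRing B] [CommRing C] (f : B →+* C) (b : B)
      (z : WittVector p B) : map f (mk p fun i => b ^ p ^ i * z.coeff i) =
        mk p fun i => f b ^ p ^ i * (map f z).coeff i := by
    ext i
    simp [map_coeff]
  have rat (b : MvPolynomial R ℚ) (z : WittVector p (MvPolynomial R ℚ)) :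
      teichmuller p b * z = mk p fun i => b ^ p ^ i * z.coeff i := by
    apply (ghostMap.bijective_of_invertible p (MvPolynomial R ℚ)).1
    rw [map_mul]
    ext1 m
    simp only [Pi.mul_apply, ghostMap_apply, ghostComponent_teichmuller]
    simp only [ghostComponent_apply, aeval_wittPolynomial, Finset.mul_sum]
    refine Finset.sum_congr rfl fun i hi => ?_
    have him : i ≤ m := Nat.lt_succ_iff.mp (Finset.mem_range.mp hi)
    rw [coeff_mk, mul_pow, ← pow_mul, ← pow_add, Nat.add_sub_cancel' him]
    ring
  have int (b : MvPolynomial R ℤ) (z : WittVector p (MvPolynomial R ℤ)) :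
      teichmuller p b * z = mk p fun i => b ^ p ^ i * z.coeff i := by
    refine map_injective (MvPolynomial.map (Int.castRingHom ℚ))
      (MvPolynomial.map_injective _ Int.cast_injective) ?_
    rw [map_mk, map_mul, map_teichmuller, rat]
  obtain ⟨b, rfl⟩ := MvPolynomial.counit_surjective R r
  obtain ⟨z, rfl⟩ := map_surjective _ (MvPolynomial.counit_surjective R) x
  rw [← map_teichmuller, ← map_mul, int, map_mk, coeff_mk]

theorem coeff_add_of_forall_lt_eq_zero (x y : WittVector p R) (n : ℕ)
    (hy : ∀ i < n, y.coeff i = 0) : (x + y).coeff n = x.coeff n + y.coeff n := by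
  have aux (a b : WittVector p R) (ha : ∀ i < n, a.coeff i = 0) (hb : ∀ i < n, b.coeff i = 0) :
      (∀ i < n, (a + b).coeff i = 0) ∧ (a + b).coeff n = a.coeff n + b.coeff n := by
    have h : a + b = verschiebung^[n] (a.shift n + b.shift n) := by
      rw [iterate_map_add, ← eq_iterate_verschiebung ha, ← eq_iterate_verschiebung hb]
    refine ⟨fun i hi => ?_, ?_⟩
    · rw [h, iterate_verschiebung_coeff_eq_zero _ hi]
    · have := iterate_verschiebung_coeff (a.shift n + b.shift n) n 0
      rw [zero_add] at this
      rw [h, this, add_coeff_zero]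
      rfl
  have ht : ∀ i < n, (tail n x).coeff i = 0 := fun i hi => by
    simp [tail, select, hi]
  obtain ⟨h0, hn⟩ := aux (tail n x) y ht hy
  conv_lhs => rw [← init_add_tail x n, add_assoc]
  rw [coeff_add_of_disjoint, hn]
  · simp [init, tail, select]
  · intro i
    by_cases hi : i < n
    · exact Or.inr (h0 i hi)
    · exact Or.inl (by simp [init, select, hi])

/-- The carry in the `n`-th coefficient of the sum of two Witt vectors. -/
noncomputable def carry (x w : WittVector p R) (n : ℕ) : R :=
  (x + w).coeff n - x.coeff n - w.coeff n

theorem carry_eq_coeff_init_add_init (x w : WittVector p R) (n : ℕ) :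
    carry x w n = (init n x + init n w).coeff n := by
  have h : x + w = init n x + init n w + tail n x + tail n w := by
    conv_lhs => rw [← init_add_tail x n, ← init_add_tail w n]
    abel
  have ht (z : WittVector p R) : ∀ i < n, (tail n z).coeff i = 0 := fun i hi => by
    simp [tail, select, hi]
  rw [carry, h, coeff_add_of_forall_lt_eq_zero _ _ _ (ht w),
    coeff_add_of_forall_lt_eq_zero _ _ _ (ht x)]
  simp only [tail, select, coeff_mk, le_refl, if_true]
  ring

theorem carry_congr {x x' w w' : WittVector p R} {n : ℕ} (hx : ∀ i < n, x.coeff i = x'.coeff i)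
    (hw : ∀ i < n, w.coeff i = w'.coeff i) : carry x w n = carry x' w' n := by
  rw [carry_eq_coeff_init_add_init, carry_eq_coeff_init_add_init, init_congr hx, init_congr hw]

theorem carry_map (f : R →+* S) (x w : WittVector p R) (n : ℕ) :
    carry (map f x) (map f w) n = f (carry x w n) := by
  simp [carry, ← map_add, map_coeff]

theorem carry_teichmuller_mul (r : R) (x w : WittVector p R) (n : ℕ) :
    carry (teichmuller p r * x) (teichmuller p r * w) n = r ^ p ^ n * carry x w n := by
  simp only [carry, ← mul_add, coeff_teichmuller_mul]
  ring

theorem dvd_carry {d : R} {x : WittVector p R} (w : WittVector p R) {n : ℕ}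
    (hx : ∀ i < n, d ∣ x.coeff i) : d ∣ carry x w n := by
  rw [← Ideal.Quotient.eq_zero_iff_dvd, ← carry_map, carry_congr (x' := 0) (w' := _) _ fun _ _ => rfl]
  · simp [carry]
  · intro i hi
    rw [map_coeff, Ideal.Quotient.eq_zero_iff_dvd _ _ |>.2 (hx i hi), zero_coeff]

end Carry

section Valuation

variable {p : ℕ} [hp : Fact p.Prime] {L : Type*} [Field L] (v : AddValuation L (WithTop ℤ))

theorem le_addValuation_carry {t : L} (ht : v t = 1) (e N : ℕ) (x w : WittVector p L) (n : ℕ)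
    (hx : ∀ i < n, (((e : ℤ) - p ^ i * N : ℤ) : WithTop ℤ) ≤ v (x.coeff i))
    (hw : ∀ i < n, ((-(p ^ i * N : ℤ) : ℤ) : WithTop ℤ) ≤ v (w.coeff i)) :
    (((e : ℤ) - p ^ n * N : ℤ) : WithTop ℤ) ≤ v (carry x w n) := by
  have hpow (a : ℕ) : v (t ^ a) = ((a : ℤ) : WithTop ℤ) := by
    rw [AddValuation.map_pow, ht]
    simp
  have ht0 : t ≠ 0 := by
    rintro rfl
    simp at ht
  have key (a : ℕ) (b : ℤ) (z : L) :
      ((b - a : ℤ) : WithTop ℤ) ≤ v z ↔ (b : WithTop ℤ) ≤ v (t ^ a * z) := by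
    rw [AddValuation.map_mul, hpow]
    cases v z with
    | top => simp
    | coe c => norm_cast; omega
  let O : Subring L :=
    { carrier := {z | 0 ≤ v z}
      mul_mem' := fun {a b} ha hb => by
        simpa using add_nonneg ha hb
      one_mem' := by simp
      add_mem' := fun {a b} ha hb => v.map_le_add ha hb
      zero_mem' := by simp
      neg_mem' := fun {a} ha => by simpa using ha }
  have hdiv (z : L) (hz : ((e : ℤ) : WithTop ℤ) ≤ v z) : ∃ q : O, t ^ e * (q : L) = z := by
    have h : t ^ e * (t⁻¹ ^ e * z) = z := by
      rw [← mul_assoc, ← mul_pow, mul_inv_cancel₀ ht0, one_pow, one_mul]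
    refine ⟨⟨t⁻¹ ^ e * z, ?_⟩, h⟩
    have := (key e e (t⁻¹ ^ e * z)).2 (by rwa [h])
    rwa [sub_self] at this
  have hx' (i : ℕ) : ∃ q : O, i < n → t ^ e * (q : L) = t ^ (p ^ i * N) * x.coeff i := by
    by_cases hi : i < n
    · obtain ⟨q, hq⟩ := hdiv (t ^ (p ^ i * N) * x.coeff i)
        ((key _ _ _).1 (by exact_mod_cast hx i hi))
      exact ⟨q, fun _ => hq⟩
    · exact ⟨0, fun h => absurd h hi⟩
  have hw' (i : ℕ) : ∃ q : O, i < n → (q : L) = t ^ (p ^ i * N) * w.coeff i := by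
    by_cases hi : i < n
    · refine ⟨⟨t ^ (p ^ i * N) * w.coeff i, ?_⟩, fun _ => rfl⟩
      have := (key (p ^ i * N) 0 (w.coeff i)).1 (by
        simpa only [zero_sub, Nat.cast_mul, Nat.cast_pow] using hw i hi)
      exact_mod_cast this
    · exact ⟨0, fun h => absurd h hi⟩
  choose X hX using hx'
  choose W hW using hw'
  have hteO : t ^ e ∈ O := by
    change 0 ≤ v (t ^ e)
    rw [hpow]
    exact_mod_cast Int.natCast_nonneg e
  obtain ⟨q, hq⟩ := dvd_carry (d := (⟨t ^ e, hteO⟩ : O)) (x := mk p fun i => ⟨t ^ e, hteO⟩ * X i)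
    (mk p W) (n := n) fun i _ => ⟨X i, rfl⟩
  have hcarry : (t ^ N) ^ p ^ n * carry x w n = t ^ e * (q : L) := by
    rw [← carry_teichmuller_mul]
    calc _ = carry (map O.subtype (mk p fun i => ⟨t ^ e, hteO⟩ * X i))
            (map O.subtype (mk p W)) n := by
          refine carry_congr (fun i hi => ?_) fun i hi => ?_
          · rw [coeff_teichmuller_mul, map_coeff, ← pow_mul, mul_comm N, ← hX i hi]
            rfl
          · rw [coeff_teichmuller_mul, map_coeff, ← pow_mul, mul_comm N, ← hW i hi]
            rfl
      _ = _ := by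
          rw [carry_map, hq]
          rfl
  have := (key (p ^ n * N) e (carry x w n)).2 (by
    rw [mul_comm (p ^ n), pow_mul, hcarry, AddValuation.map_mul, hpow]
    exact le_add_of_nonneg_right q.2)
  exact_mod_cast this

/-- If `F(x) = x + w` in the coefficients below `n`, bounds on the poles of `w` give bounds on the
poles of `x`. -/
theorem le_addValuation_coeff_of_pow_eq {t : L} (ht : v t = 1) (m : ℕ) (x w : WittVector p L)
    (n : ℕ) (hxw : ∀ i < n, x.coeff i ^ p = (x + w).coeff i)
    (hw : ∀ i < n, ((-(p ^ (i + 1) * m : ℤ) : ℤ) : WithTop ℤ) ≤ v (w.coeff i)) :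
    ∀ i < n, ((-(p ^ i * m : ℤ) : ℤ) : WithTop ℤ) ≤ v (x.coeff i) := by
  have hp1 : (1 : ℤ) ≤ p := by exact_mod_cast hp.out.one_le
  intro i
  induction i using Nat.strong_induction_on with
  | _ i ih =>
  intro hi
  have hc : ((-(p ^ (i + 1) * m : ℤ) : ℤ) : WithTop ℤ) ≤ v (carry x w i) := by
    have := le_addValuation_carry v ht 0 (p * m) x w i
      (fun j hj => le_trans (WithTop.coe_le_coe.2 ?_) (ih j hj (hj.trans hi)))
      (fun j hj => le_trans (WithTop.coe_le_coe.2 (le_of_eq ?_)) (hw j (hj.trans hi)))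
    · refine le_trans (WithTop.coe_le_coe.2 (le_of_eq ?_)) this
      push_cast
      ring
    · have : (0 : ℤ) ≤ p ^ j * m := by positivity
      push_cast
      nlinarith
    · push_cast
      ring
  have hpow : x.coeff i ^ p = x.coeff i + (w.coeff i + carry x w i) := by
    rw [hxw i hi, carry]
    ring
  have hv : min (v (x.coeff i)) ((-(p ^ (i + 1) * m : ℤ) : ℤ) : WithTop ℤ) ≤
      p • v (x.coeff i) := by
    rw [← AddValuation.map_pow, hpow]
    exact v.map_le_add (min_le_left _ _) ((min_le_right _ _).trans (v.map_le_add (hw i hi) hc))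
  cases hvx : v (x.coeff i) with
  | top => simp
  | coe c =>
    rw [hvx, ← WithTop.coe_nsmul, nsmul_eq_mul] at hv
    have hv' : min c (-(p ^ (i + 1) * m : ℤ)) ≤ p * c := by exact_mod_cast hv
    have hpm : (0 : ℤ) ≤ p ^ i * m := by positivity
    have hp2 : (2 : ℤ) ≤ p := by exact_mod_cast hp.out.two_le
    norm_cast
    push_cast
    by_contra! hlt
    rw [pow_succ] at hv'
    rcases min_le_iff.1 hv' with h | h <;> nlinarith

end Valuation

end WittVector

/-- In the Artin–Schreier–Witt tower setting of length `n+1` (with `n ≥ 1`) —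
`K = k((s))`, `F(y) − y = u` with `v_K(u_i) = −ν_i`, `ν_i` prime to `p`, and
`L_j = K(y_0,…,y_{j−1})` cyclic totally ramified of degree `p^j` over `K` — the element
`z = u_n + y_n − y_n^p` lies in `L_n`, and `v_{L_n}(z) ≥ −(p^{n+1} − p + 1)·m_n`, where
`m_n = max_{0≤i≤n−1} p^{n−1−i} ν_i`. -/
theorem asw_carry_valuation_bound (p : ℕ) [Fact p.Prime] (k : Type*) [Field k] [CharP k p]
    [PerfectField k] (n : ℕ) (hn : 1 ≤ n)
    -- `K` is the field `k((s))` of Laurent series over `k`, with valuation `v_K = order ∘ ι`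
    (K : Type*) [Field K] (ι : K ≃+* LaurentSeries k)
    -- the Witt vector `u` of length `n+1` over `K`, with pole orders `ν_i` prime to `p`
    (u : TruncatedWittVector p (n + 1) K)
    (ν : ℕ → ℕ) (hν : ∀ i ≤ n, 0 < ν i ∧ ¬ p ∣ ν i)
    (hu : ∀ i : Fin (n + 1), u.coeff i ≠ 0)
    (hord : ∀ i : Fin (n + 1), (ι (u.coeff i)).order = -(ν i.val : ℤ))
    -- a separable closure `Ω` of `K` and a solution `y` of `F(y) − y = u` with entries in `Ω`
    (Ω : Type*) [Field Ω] [Algebra K Ω] [IsSepClosed Ω] [Algebra.IsSeparable K Ω]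
    (y : TruncatedWittVector p (n + 1) Ω)
    (hy : twFrobenius p (n + 1) y - y = twMap p (n + 1) (algebraMap K Ω) u)
    -- `L_n = K(y_0, …, y_{n−1})`, cyclic totally ramified of degree `p^n` over `K`
    (Ln : IntermediateField K Ω)
    (hLn : Ln = IntermediateField.adjoin K {x | ∃ i : Fin (n + 1), i.val < n ∧ y.coeff i = x})
    [IsGalois K ↥Ln] [FiniteDimensional K ↥Ln] [IsCyclic (↥Ln ≃ₐ[K] ↥Ln)]
    (hdeg : Module.finrank K ↥Ln = p ^ n)
    -- the normalized valuation `v_{L_n}` and a uniformizer of `L_n`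
    (v : ↥Ln → WithTop ℤ) (hv : IsAddValuation v) (t : ↥Ln) (ht : v t = 1)
    (hvK : ∀ x : K, x ≠ 0 →
      v (algebraMap K ↥Ln x) = ((p ^ n * (ι x).order : ℤ) : WithTop ℤ))
    -- the element `z = u_n + y_n − y_n^p` lies in `L_n`
    (hz : algebraMap K Ω (u.coeff (Fin.last n)) + y.coeff (Fin.last n)
        - y.coeff (Fin.last n) ^ p ∈ Ln) :
    ((-(((p : ℤ) ^ (n + 1) - p + 1) *
        (((Finset.range n).sup fun i => p ^ (n - 1 - i) * ν i : ℕ) : ℤ)) : ℤ) : WithTop ℤ) ≤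
      v ⟨algebraMap K Ω (u.coeff (Fin.last n)) + y.coeff (Fin.last n)
          - y.coeff (Fin.last n) ^ p, hz⟩ := by
  obtain ⟨hv0, hvmul, hvadd⟩ := hv
  have hv1 : v 1 = 0 := by
    have h := hvmul 1 1
    rw [one_mul] at h
    cases h1 : v 1 with
    | top => exact absurd ((hv0 1).1 h1) one_ne_zero
    | coe c =>
      rw [h1] at h
      have h' : c = c + c := by exact_mod_cast h
      have : c = 0 := by omega
      simp [this]
  let V : AddValuation ↥Ln (WithTop ℤ) := AddValuation.of v ((hv0 0).2 rfl) hv1 hvadd hvmul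
  set m := (Finset.range n).sup fun i => p ^ (n - 1 - i) * ν i with hm
  have hmem (i : Fin (n + 1)) (hi : i.val < n) : y.coeff i ∈ Ln := by
    rw [hLn]
    exact IntermediateField.subset_adjoin _ _ ⟨i, hi, rfl⟩
  let x : WittVector p ↥Ln := WittVector.mk p fun i =>
    if hi : i < n then ⟨y.coeff ⟨i, by omega⟩, hmem _ hi⟩ else 0
  let w : WittVector p ↥Ln := WittVector.map (algebraMap K ↥Ln) u.out
  have hxc (i : Fin (n + 1)) (hi : i.val < n) :
      (WittVector.map (algebraMap ↥Ln Ω) x).coeff i = y.out.coeff i := by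
    rw [TruncatedWittVector.coeff_out, WittVector.map_coeff]
    simp only [x, WittVector.coeff_mk, hi, dif_pos]
    rfl
  have hwc (i : Fin (n + 1)) :
      (WittVector.map (algebraMap ↥Ln Ω) w).coeff i = algebraMap K Ω (u.coeff i) := by
    simp only [w, WittVector.map_coeff, TruncatedWittVector.coeff_out]
    exact (IsScalarTower.algebraMap_apply K ↥Ln Ω _).symm
  have hyw (i : Fin (n + 1)) : y.coeff i ^ p =
      (y.out + WittVector.map (algebraMap ↥Ln Ω) w).coeff i := by
    have hu' : WittVector.truncate (n + 1) (WittVector.map (algebraMap ↥Ln Ω) w) =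
        twMap p (n + 1) (algebraMap K Ω) u := by
      ext j
      rw [WittVector.coeff_truncate, hwc, twMap, TruncatedWittVector.coeff_mk]
    have hy' : WittVector.truncate (n + 1) y.out = y := TruncatedWittVector.truncateFun_out y
    rw [← WittVector.coeff_truncate, map_add, hu', hy', ← hy, add_sub_cancel, twFrobenius,
      TruncatedWittVector.coeff_mk]
  have hcarry (i : Fin (n + 1)) : algebraMap ↥Ln Ω (WittVector.carry x w i) =
      y.coeff i ^ p - y.coeff i - algebraMap K Ω (u.coeff i) := by
    rw [← WittVector.carry_map, WittVector.carry_congr (x' := y.out)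
      (fun j hj => hxc ⟨j, by omega⟩ (by simp only; omega)) (fun _ _ => rfl), WittVector.carry,
      ← hyw, hwc, TruncatedWittVector.coeff_out]
  have hpole : ∀ i < n, ((-(p ^ (i + 1) * m : ℤ) : ℤ) : WithTop ℤ) ≤ V (w.coeff i) := by
    intro i hi
    let i' : Fin (n + 1) := ⟨i, by omega⟩
    have hwi : w.coeff i = algebraMap K ↥Ln (u.coeff i') := by
      simp only [w, WittVector.map_coeff]
      exact congrArg _ (TruncatedWittVector.coeff_out u i')
    have hle : p ^ (n - 1 - i) * ν i ≤ m :=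
      Finset.le_sup (f := fun i => p ^ (n - 1 - i) * ν i) (Finset.mem_range.2 hi)
    have hmul : p ^ n * ν i ≤ p ^ (i + 1) * m := by
      calc p ^ n * ν i = p ^ (i + 1) * (p ^ (n - 1 - i) * ν i) := by
            rw [← mul_assoc, ← pow_add]
            congr 2
            omega
        _ ≤ _ := Nat.mul_le_mul_left _ hle
    have hmul' : (p : ℤ) ^ n * ν i ≤ p ^ (i + 1) * m := by exact_mod_cast hmul
    change _ ≤ v (w.coeff i)
    rw [hwi, hvK _ (hu i'), hord i']
    refine WithTop.coe_le_coe.2 ?_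
    rw [mul_neg]
    exact neg_le_neg hmul'
  have hfrob : ∀ i < n, x.coeff i ^ p = (x + w).coeff i := by
    intro i hi
    have h1 := hcarry ⟨i, by omega⟩
    have h2 := hxc ⟨i, by omega⟩ hi
    have h3 := hwc ⟨i, by omega⟩
    rw [TruncatedWittVector.coeff_out, WittVector.map_coeff] at h2
    rw [WittVector.map_coeff] at h3
    apply (algebraMap ↥Ln Ω).injective
    rw [WittVector.carry, map_sub, map_sub, h2, h3] at h1
    rw [map_pow, h2]
    linear_combination -h1
  have hx := WittVector.le_addValuation_coeff_of_pow_eq V ht m x w n hfrob hpole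
  have hp1 : 1 ≤ p := (Fact.out : p.Prime).one_le
  have hbound := WittVector.le_addValuation_carry V ht ((p - 1) * m) (p * m) x w n
    (fun i hi => le_trans (WithTop.coe_le_coe.2 ?_) (hx i hi))
    (fun i hi => le_trans (WithTop.coe_le_coe.2 (le_of_eq ?_)) (hpole i hi))
  · have hzc : (⟨algebraMap K Ω (u.coeff (Fin.last n)) + y.coeff (Fin.last n)
        - y.coeff (Fin.last n) ^ p, hz⟩ : ↥Ln) = -WittVector.carry x w n := by
      apply (algebraMap ↥Ln Ω).injective
      have h := hcarry (Fin.last n)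
      rw [Fin.val_last] at h
      rw [map_neg, h]
      change algebraMap K Ω (u.coeff (Fin.last n)) + y.coeff (Fin.last n)
        - y.coeff (Fin.last n) ^ p = _
      ring
    rw [hzc]
    change _ ≤ V (-WittVector.carry x w n)
    rw [AddValuation.map_neg]
    refine le_trans (WithTop.coe_le_coe.2 (le_of_eq ?_)) hbound
    push_cast [Nat.cast_sub hp1]
    ring
  · have h1 : (1 : ℤ) ≤ p ^ i := by exact_mod_cast Nat.one_le_pow _ _ hp1
    have h2 : (0 : ℤ) ≤ (p - 1) * m := mul_nonneg (by omega) (by positivity)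
    push_cast [Nat.cast_sub hp1]
    nlinarith
  · push_cast
    ring
end

section
/- In the Artin–Schreier–Witt tower setting of length n+1 (with n ≥ 0), the normalized valuation of y_n in L_{n+1} satisfies v_{L_{n+1}}(y_n) ≥ −p^n · m_{n+1}, where m_{n+1} = max_{0≤i≤n} p^{n−i} ν_i; moreover equality holds if and only if ν_n = m_{n+1}. -/
set_option synthInstance.maxHeartbeats 1000000
set_option maxHeartbeats 1600000

namespace WittVector

variable {p : ℕ} [hp : Fact p.Prime] {R : Type*} [CommRing R]

/-- Rescaling the components of a Witt vector, the `n`-th one by `a ^ p ^ n`. -/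
def rescale (a : R) (x : WittVector p R) : WittVector p R :=
  mk p fun n => a ^ p ^ n * x.coeff n

omit hp in
theorem rescale_coeff (a : R) (x : WittVector p R) (n : ℕ) :
    (rescale a x).coeff n = a ^ p ^ n * x.coeff n := rfl

theorem map_rescale {S : Type*} [CommRing S] (f : R →+* S) (a : R) (x : WittVector p R) :
    map f (rescale a x) = rescale (f a) (map f x) := by
  ext n
  simp [rescale_coeff, map_coeff]

theorem ghostComponent_rescale (a : R) (x : WittVector p R) (n : ℕ) :
    ghostComponent n (rescale a x) = a ^ p ^ n * ghostComponent n x := by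
  simp only [ghostComponent_apply, aeval_wittPolynomial, rescale_coeff, Finset.mul_sum]
  refine Finset.sum_congr rfl fun i hi => ?_
  have h : p ^ i * p ^ (n - i) = p ^ n := by
    rw [← pow_add, Nat.add_sub_cancel' (Finset.mem_range_succ_iff.mp hi)]
  rw [mul_pow, ← pow_mul, h]
  ring

theorem rescale_add (a : R) (x y : WittVector p R) :
    rescale a (x + y) = rescale a x + rescale a y := by
  have hQ : ∀ (a : MvPolynomial R ℚ) (x y : WittVector p (MvPolynomial R ℚ)),
      rescale a (x + y) = rescale a x + rescale a y := fun a x y => by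
    refine (ghostMap.bijective_of_invertible p (MvPolynomial R ℚ)).1 (funext fun n => ?_)
    rw [RingHom.map_add]
    simp only [Pi.add_apply, ghostMap_apply, ghostComponent_rescale, map_add, mul_add]
  have hZ : ∀ (a : MvPolynomial R ℤ) (x y : WittVector p (MvPolynomial R ℤ)),
      rescale a (x + y) = rescale a x + rescale a y := fun a x y => by
    refine map_injective (MvPolynomial.map (Int.castRingHom ℚ))
      (MvPolynomial.map_injective _ Int.cast_injective) ?_
    simp only [map_rescale, map_add, hQ]
  obtain ⟨b, rfl⟩ := MvPolynomial.counit_surjective R a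
  obtain ⟨x, rfl⟩ := map_surjective _ (MvPolynomial.counit_surjective R) x
  obtain ⟨y, rfl⟩ := map_surjective _ (MvPolynomial.counit_surjective R) y
  simp only [← map_rescale, ← map_add, hZ]

theorem iterate_verschiebung_add (n : ℕ) (x y : WittVector p R) :
    verschiebung^[n] (x + y) = verschiebung^[n] x + verschiebung^[n] y := by
  induction n with
  | zero => rfl
  | succ n ih => simp only [Function.iterate_succ_apply', ih, map_add]

theorem tail_eq_iterate_verschiebung (n : ℕ) (x : WittVector p R) :
    tail n x = verschiebung^[n] (mk p fun i => x.coeff (i + n)) := by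
  ext j
  rcases lt_or_ge j n with h | h
  · rw [iterate_verschiebung_coeff_eq_zero _ h]
    simp [tail, select, h]
  · obtain ⟨m, rfl⟩ := Nat.exists_eq_add_of_le' h
    rw [iterate_verschiebung_coeff]
    simp [tail, select]

/-- Adding a Witt vector whose components below `n` vanish adds its `n`-th component. -/
theorem tail_add_coeff (n : ℕ) (x y : WittVector p R) :
    (tail n x + y).coeff n = x.coeff n + y.coeff n := by
  have h : (init n y + (tail n x + tail n y)).coeff n =
      (init n y).coeff n + (tail n x + tail n y).coeff n := by
    refine coeff_add_of_disjoint n _ _ fun j => ?_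
    rcases lt_or_ge j n with hj | hj
    · right
      rw [tail_eq_iterate_verschiebung, tail_eq_iterate_verschiebung,
        ← iterate_verschiebung_add, iterate_verschiebung_coeff_eq_zero _ hj]
    · left
      simp [init, select, hj]
  have hy : (init n y).coeff n = 0 := by simp [init, select]
  conv_lhs => rw [← init_add_tail y n, add_left_comm, h, hy, zero_add]
  rw [tail_eq_iterate_verschiebung, tail_eq_iterate_verschiebung, ← iterate_verschiebung_add]
  have h0 := iterate_verschiebung_coeff
    ((mk p fun i => x.coeff (i + n)) + mk p fun i => y.coeff (i + n)) n 0
  simpa [add_coeff_zero] using h0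

theorem add_coeff_eq_add_init_add_coeff (n : ℕ) (x y : WittVector p R) :
    (x + y).coeff n = x.coeff n + (init n x + y).coeff n := by
  conv_lhs => rw [← init_add_tail x n, add_right_comm, add_comm, tail_add_coeff]

omit hp in
theorem coeff_init_of_lt {n j : ℕ} (h : j < n) (x : WittVector p R) :
    (init n x).coeff j = x.coeff j := by
  simp [init, select, h]

omit hp in
theorem coeff_init_of_le {n j : ℕ} (h : n ≤ j) (x : WittVector p R) :
    (init n x).coeff j = 0 := by
  simp [init, select, h]

theorem init_add_coeff_eq_init_add_init_coeff (n : ℕ) (x y : WittVector p R) :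
    (init n x + y).coeff n = (init n x + init (n + 1) y).coeff n := by
  have h := congrArg (fun z => z.coeff n) (init_add (init n x) y (n + 1))
  have h' := congrArg (fun z => z.coeff n) (init_add (init n x) (init (n + 1) y) (n + 1))
  simp only [coeff_init_of_lt n.lt_succ_self, init_init] at h h'
  rw [h, h']

/-- If all components of `x` lie in an ideal `I`, then adding `x` does not change the components
of a Witt vector modulo `I`. -/
theorem add_coeff_sub_coeff_mem (I : Ideal R) (x y : WittVector p R)
    (hx : ∀ n, x.coeff n ∈ I) (n : ℕ) : (x + y).coeff n - y.coeff n ∈ I := by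
  have h0 : map (Ideal.Quotient.mk I) x = 0 := by
    ext j
    simpa [map_coeff, Ideal.Quotient.eq_zero_iff_mem] using hx j
  rw [← Ideal.Quotient.mk_eq_mk_iff_sub_mem, ← map_coeff, ← map_coeff, map_add, h0, zero_add]

end WittVector

namespace AddValuation

variable {F : Type*} [Field F] (w : AddValuation F (WithTop ℤ))

/-- The elements of nonnegative additive valuation. -/
def nonnegSubring : Subring F where
  carrier := {z | 0 ≤ w z}
  mul_mem' {a b} ha hb := by
    rw [Set.mem_ofPred_eq, w.map_mul]
    exact add_nonneg ha hb
  one_mem' := by simp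
  add_mem' {a b} ha hb := w.map_le_add ha hb
  zero_mem' := by simp
  neg_mem' {a} ha := by
    rw [Set.mem_ofPred_eq, w.map_neg]
    exact ha

/-- The ideal of elements of positive additive valuation. -/
def posIdeal : Ideal w.nonnegSubring where
  carrier := {z | 0 < w z}
  add_mem' {a b} ha hb := by
    exact w.map_lt_add ha hb
  zero_mem' := by simp
  smul_mem' c z hz := by
    change 0 < w (c * z)
    rw [w.map_mul]
    exact lt_of_lt_of_le hz (le_add_of_nonneg_left c.2)

/-- The cross terms in the `n`-th component of a sum of Witt vectors have large valuation. -/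
theorem exists_wittVector_add_coeff_eq {p : ℕ} [Fact p.Prime] {a : F} (ha : a ≠ 0) (n : ℕ)
    (x y : WittVector p F) (hx : ∀ j < n, w (a ^ p ^ j) < w (x.coeff j))
    (hy : ∀ j ≤ n, w (a ^ p ^ j) ≤ w (y.coeff j)) :
    ∃ r, w (a ^ p ^ n) < w r ∧ (x + y).coeff n = x.coeff n + y.coeff n + r := by
  have hne : ∀ j, w (a ^ p ^ j) ≠ ⊤ := fun j => w.ne_top_iff.mpr (pow_ne_zero _ ha)
  have key : ∀ (j : ℕ) (z : F), w z = w (a ^ p ^ j) + w ((a ^ p ^ j)⁻¹ * z) := fun j z => by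
    rw [← w.map_mul, mul_inv_cancel_left₀ (pow_ne_zero _ ha)]
  have hx' : ∀ j, 0 < w ((a ^ p ^ j)⁻¹ * (WittVector.init n x).coeff j) := fun j => by
    rcases lt_or_ge j n with h | h
    · rw [WittVector.coeff_init_of_lt h]
      have := hx j h
      rw [key j (x.coeff j)] at this
      rwa [← WithTop.add_lt_add_iff_left (hne j), add_zero]
    · simp [WittVector.coeff_init_of_le h]
  have hy' : ∀ j, 0 ≤ w ((a ^ p ^ j)⁻¹ * (WittVector.init (n + 1) y).coeff j) := fun j => by
    rcases lt_or_ge j (n + 1) with h | h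
    · rw [WittVector.coeff_init_of_lt h]
      have := hy j (Nat.lt_succ_iff.mp h)
      rw [key j (y.coeff j)] at this
      rwa [← WithTop.add_le_add_iff_left (hne j), add_zero]
    · simp [WittVector.coeff_init_of_le h]
  let x' : WittVector p w.nonnegSubring := .mk p fun j => ⟨_, (hx' j).le⟩
  let y' : WittVector p w.nonnegSubring := .mk p fun j => ⟨_, hy' j⟩
  have hX : WittVector.init n x = .rescale a (.map w.nonnegSubring.subtype x') := by
    ext j
    exact (mul_inv_cancel_left₀ (pow_ne_zero _ ha) _).symm
  have hY : WittVector.init (n + 1) y = .rescale a (.map w.nonnegSubring.subtype y') := by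
    ext j
    exact (mul_inv_cancel_left₀ (pow_ne_zero _ ha) _).symm
  have hmem : 0 < w (((x' + y').coeff n - y'.coeff n : w.nonnegSubring) : F) :=
    WittVector.add_coeff_sub_coeff_mem w.posIdeal x' y' hx' n
  refine ⟨a ^ p ^ n * ((x' + y').coeff n - y'.coeff n : w.nonnegSubring), ?_, ?_⟩
  · rw [w.map_mul]
    simpa using (WithTop.add_lt_add_iff_left (hne n)).mpr hmem
  · have hyn : y.coeff n = a ^ p ^ n * (y'.coeff n : F) := by
      rw [← WittVector.coeff_init_of_lt n.lt_succ_self y, hY]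
      rfl
    rw [WittVector.add_coeff_eq_add_init_add_coeff,
      WittVector.init_add_coeff_eq_init_add_init_coeff, hX, hY, ← WittVector.rescale_add,
      ← _root_.map_add, hyn, WittVector.rescale_coeff, WittVector.map_coeff]
    push_cast
    simp only [Subring.coe_subtype]
    ring

/-- The valuation of a root of `X ^ q - X - s` when `s` has a pole. -/
theorem le_and_eq_iff_of_pow_eq_add {q : ℕ} (hq : 2 ≤ q) {y s : F}
    (h : y ^ q = y + s) {c : ℤ} (hc : 0 < c) (hs : ((-(q * c) : ℤ) : WithTop ℤ) ≤ w s) :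
    ((-c : ℤ) : WithTop ℤ) ≤ w y ∧
      (w y = ((-c : ℤ) : WithTop ℤ) ↔ w s = ((-(q * c) : ℤ) : WithTop ℤ)) := by
  have hs' : s = y ^ q - y := by rw [h]; ring
  rcases eq_or_ne y 0 with rfl | hy
  · have : s = 0 := by rw [hs', zero_pow (by omega), sub_zero]
    rw [this, w.map_zero]
    exact ⟨le_top, iff_of_false WithTop.top_ne_coe WithTop.top_ne_coe⟩
  obtain ⟨d, hd⟩ := WithTop.ne_top_iff_exists.mp (w.ne_top_iff.mpr hy)
  have hpow : w (y ^ q) = ((q * d : ℤ) : WithTop ℤ) := by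
    rw [w.map_pow, ← hd]
    norm_cast
  have hq' : (2 : ℤ) ≤ q := by exact_mod_cast hq
  have hneg : d < 0 → w s = ((q * d : ℤ) : WithTop ℤ) := fun hd0 => by
    rw [hs', w.map_sub_eq_of_lt_left, hpow]
    rw [hpow, ← hd]
    norm_cast
    nlinarith
  have hlow : -c ≤ d := by
    by_contra! hlt
    rw [hneg (by linarith)] at hs
    norm_cast at hs
    nlinarith
  rw [← hd]
  refine ⟨by exact_mod_cast hlow, fun he => ?_, fun he => ?_⟩
  · have he : d = -c := by exact_mod_cast he
    rw [hneg (by linarith), he, mul_neg]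
  · by_contra hne
    have hlt : -c < d := lt_of_le_of_ne hlow fun e => hne (by rw [e])
    refine absurd he (ne_of_gt ?_)
    rw [hs']
    refine lt_of_lt_of_le (lt_min ?_ ?_) (w.map_sub _ _)
    · rw [hpow]
      norm_cast
      nlinarith
    · rw [← hd]
      norm_cast
      nlinarith

end AddValuation

/-- The number `max_{j ≤ i} p ^ (i - j) * ν j` attached to the pole orders `ν` of a Witt vector. -/
def wittPoleOrder (p : ℕ) (ν : ℕ → ℕ) (i : ℕ) : ℕ :=
  (Finset.range (i + 1)).sup fun j => p ^ (i - j) * ν j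

theorem pow_mul_le_wittPoleOrder (p : ℕ) (ν : ℕ → ℕ) {i j : ℕ} (h : j ≤ i) :
    p ^ (i - j) * ν j ≤ wittPoleOrder p ν i :=
  Finset.le_sup (f := fun j => p ^ (i - j) * ν j) (Finset.mem_range_succ_iff.mpr h)

theorem le_wittPoleOrder (p : ℕ) (ν : ℕ → ℕ) (i : ℕ) : ν i ≤ wittPoleOrder p ν i := by
  simpa using pow_mul_le_wittPoleOrder p ν le_rfl

theorem pow_mul_wittPoleOrder_le (p : ℕ) (ν : ℕ → ℕ) {i j : ℕ} (h : j ≤ i) :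
    p ^ (i - j) * wittPoleOrder p ν j ≤ wittPoleOrder p ν i := by
  obtain ⟨l, hl, he⟩ := Finset.exists_mem_eq_sup (Finset.range (j + 1)) ⟨0, by simp⟩
    fun l => p ^ (j - l) * ν l
  have hl' : l ≤ j := Finset.mem_range_succ_iff.mp hl
  rw [wittPoleOrder, he, ← mul_assoc, ← pow_add, show i - j + (j - l) = i - l by omega]
  exact pow_mul_le_wittPoleOrder p ν (hl'.trans h)

/-- Valuations of the components of a solution of an Artin–Schreier–Witt equation, for a
valuation under which the `i`-th component of the right-hand side has a pole of order
`p ^ (n + 1) * ν i`. -/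
theorem AddValuation.artinSchreierWitt {F : Type*} [Field F] (w : AddValuation F (WithTop ℤ))
    {t : F} (ht : w t = 1) {p : ℕ} [hp : Fact p.Prime] (n : ℕ) {ν : ℕ → ℕ}
    (hν : ∀ i ≤ n, 0 < ν i) (y u : WittVector p F)
    (hy : ∀ i ≤ n, y.coeff i ^ p = (y + u).coeff i)
    (hu : ∀ i ≤ n, w (u.coeff i) = ((-(p ^ (n + 1) * ν i) : ℤ) : WithTop ℤ)) (i : ℕ)
    (hi : i ≤ n) :
    ((-(p ^ n * wittPoleOrder p ν i) : ℤ) : WithTop ℤ) ≤ w (y.coeff i) ∧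
      (w (y.coeff i) = ((-(p ^ n * wittPoleOrder p ν i) : ℤ) : WithTop ℤ) ↔
        ν i = wittPoleOrder p ν i) := by
  induction i using Nat.strong_induction_on with
  | h i ih =>
  have hp1 : (1 : ℤ) < p := by exact_mod_cast hp.1.one_lt
  have hM : ∀ j ≤ n, (0 : ℤ) < wittPoleOrder p ν j := fun j hj => by
    exact_mod_cast (hν j hj).trans_le (le_wittPoleOrder p ν j)
  have ht0 : t ≠ 0 := by
    rintro rfl
    simp at ht
  set N : ℕ := p ^ (n + 1 - i) * wittPoleOrder p ν i with hN
  have hpow : ∀ j ≤ i, (p : ℤ) ^ (n + 1) = p ^ (n + 1 - i) * (p ^ (i - j) * p ^ j) := fun j hj => by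
    rw [← pow_add, ← pow_add]
    congr 1
    omega
  have hw : ∀ j, w ((t⁻¹ ^ N) ^ p ^ j) = ((-(p ^ j * N) : ℤ) : WithTop ℤ) := fun j => by
    have h1 : w t⁻¹ = ((-1 : ℤ) : WithTop ℤ) := by
      rw [w.map_inv, ht]
      rfl
    rw [← pow_mul, w.map_pow, h1]
    norm_cast
    push_cast
    simp [mul_comm]
  have hbound : ∀ j ≤ i, (p : ℤ) ^ (n + 1) * wittPoleOrder p ν j ≤ p ^ j * N := fun j hj => by
    have h1 : (p : ℤ) ^ (i - j) * wittPoleOrder p ν j ≤ wittPoleOrder p ν i := by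
      exact_mod_cast pow_mul_wittPoleOrder_le p ν hj
    calc (p : ℤ) ^ (n + 1) * wittPoleOrder p ν j
        = p ^ (n + 1 - i) * p ^ j * (p ^ (i - j) * wittPoleOrder p ν j) := by
          rw [hpow j hj]; ring
      _ ≤ p ^ (n + 1 - i) * p ^ j * wittPoleOrder p ν i := by gcongr
      _ = p ^ j * N := by rw [hN]; push_cast; ring
  obtain ⟨r, hr, hsum⟩ := w.exists_wittVector_add_coeff_eq (p := p) (a := t⁻¹ ^ N)
    (pow_ne_zero _ (inv_ne_zero ht0)) i y u (fun j hj => by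
      refine lt_of_lt_of_le ?_ (ih j hj (by omega)).1
      rw [hw]
      have h1 := hbound j hj.le
      have h2 : (0 : ℤ) < p ^ n * wittPoleOrder p ν j :=
        mul_pos (by positivity) (hM j (by omega))
      have h3 : (p : ℤ) ^ (n + 1) * wittPoleOrder p ν j = p * (p ^ n * wittPoleOrder p ν j) := by
        ring
      refine WithTop.coe_lt_coe.mpr (neg_lt_neg ?_)
      nlinarith) (fun j hj => by
      rw [hw, hu j (by omega)]
      refine WithTop.coe_le_coe.mpr (neg_le_neg ((hbound j hj).trans' ?_))
      gcongr
      exact_mod_cast le_wittPoleOrder p ν j)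
  have hc : (0 : ℤ) < p ^ n * wittPoleOrder p ν i := mul_pos (by positivity) (hM i hi)
  have hpc : (p : ℤ) * (p ^ n * wittPoleOrder p ν i) = p ^ i * N := by
    have := hpow i le_rfl
    rw [Nat.sub_self, pow_zero, one_mul] at this
    rw [hN, ← mul_assoc, ← pow_succ', this]
    push_cast
    ring
  have hr' : ((-(p * (p ^ n * wittPoleOrder p ν i)) : ℤ) : WithTop ℤ) < w r := by
    rwa [hpc, ← hw]
  have hui : w (u.coeff i) = ((-(p * (p ^ n * ν i)) : ℤ) : WithTop ℤ) := by
    rw [hu i hi, pow_succ', mul_assoc]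
  have hule : ((-(p * (p ^ n * wittPoleOrder p ν i)) : ℤ) : WithTop ℤ) ≤ w (u.coeff i) := by
    rw [hui]
    refine WithTop.coe_le_coe.mpr (neg_le_neg ?_)
    gcongr
    exact_mod_cast le_wittPoleOrder p ν i
  have hroot := w.le_and_eq_iff_of_pow_eq_add hp.1.two_le (s := u.coeff i + r)
    (by rw [hy i hi, hsum, add_assoc]) hc (w.map_le_add hule hr'.le)
  refine ⟨hroot.1, hroot.2.trans ⟨fun h => ?_, fun h => ?_⟩⟩
  · by_contra hne
    have hlt : ν i < wittPoleOrder p ν i := lt_of_le_of_ne (le_wittPoleOrder p ν i) hne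
    refine absurd h (ne_of_gt (w.map_lt_add ?_ hr'))
    rw [hui]
    refine WithTop.coe_lt_coe.mpr (neg_lt_neg ?_)
    have : (0 : ℤ) < p := by omega
    gcongr
  · rw [← h] at hr' ⊢
    rw [w.map_add_eq_of_lt_left, hui]
    rwa [hui]

theorem out_twMap {p m : ℕ} [Fact p.Prime] {R S : Type*} [CommRing R] [CommRing S] (f : R →+* S)
    (x : TruncatedWittVector p m R) :
    (twMap p m f x).out = WittVector.map f x.out := by
  ext j
  rw [WittVector.map_coeff]
  by_cases hj : j < m <;> simp [TruncatedWittVector.out, twMap, hj]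

/-- In the Artin–Schreier–Witt tower setting of length `n+1` (with `n ≥ 0`) —
`K = k((s))`, `F(y) − y = u` with `v_K(u_i) = −ν_i`, `ν_i` prime to `p`, and
`L_j = K(y_0,…,y_{j−1})` cyclic totally ramified of degree `p^j` over `K` — the normalized
valuation of `y_n` in `L_{n+1}` satisfies `v_{L_{n+1}}(y_n) ≥ −p^n·m_{n+1}`, where
`m_{n+1} = max_{0≤i≤n} p^{n−i} ν_i`; moreover equality holds iff `ν_n = m_{n+1}`. -/
theorem asw_valuation_of_yn (p : ℕ) [Fact p.Prime] (k : Type*) [Field k] [CharP k p]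
    [PerfectField k] (n : ℕ)
    -- `K` is the field `k((s))` of Laurent series over `k`, with valuation `v_K = order ∘ ι`
    (K : Type*) [Field K] (ι : K ≃+* LaurentSeries k)
    -- the Witt vector `u` of length `n+1` over `K`, with pole orders `ν_i` prime to `p`
    (u : TruncatedWittVector p (n + 1) K)
    (ν : ℕ → ℕ) (hν : ∀ i ≤ n, 0 < ν i ∧ ¬ p ∣ ν i)
    (hu : ∀ i : Fin (n + 1), u.coeff i ≠ 0)
    (hord : ∀ i : Fin (n + 1), (ι (u.coeff i)).order = -(ν i.val : ℤ))
    -- a separable closure `Ω` of `K` and a solution `y` of `F(y) − y = u` with entries in `Ω`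
    (Ω : Type*) [Field Ω] [Algebra K Ω] [IsSepClosed Ω] [Algebra.IsSeparable K Ω]
    (y : TruncatedWittVector p (n + 1) Ω)
    (hy : twFrobenius p (n + 1) y - y = twMap p (n + 1) (algebraMap K Ω) u)
    -- `L_{n+1} = K(y_0, …, y_n)`, cyclic totally ramified of degree `p^{n+1}` over `K`
    (L : IntermediateField K Ω)
    (hL : L = IntermediateField.adjoin K (Set.range fun i => y.coeff i))
    [IsGalois K ↥L] [FiniteDimensional K ↥L] [IsCyclic (↥L ≃ₐ[K] ↥L)]
    (hdeg : Module.finrank K ↥L = p ^ (n + 1))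
    -- the normalized valuation `v_{L_{n+1}}` and a uniformizer of `L_{n+1}`
    (v : ↥L → WithTop ℤ) (hv : IsAddValuation v) (t : ↥L) (ht : v t = 1)
    (hvK : ∀ x : K, x ≠ 0 →
      v (algebraMap K ↥L x) = ((p ^ (n + 1) * (ι x).order : ℤ) : WithTop ℤ))
    -- `y_n` lies in `L_{n+1}`
    (hyn : y.coeff (Fin.last n) ∈ L) :
    ((-(((p : ℤ) ^ n) *
        (((Finset.range (n + 1)).sup fun i => p ^ (n - i) * ν i : ℕ) : ℤ)) : ℤ) : WithTop ℤ) ≤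
      v ⟨y.coeff (Fin.last n), hyn⟩ ∧
    (v ⟨y.coeff (Fin.last n), hyn⟩ =
        ((-(((p : ℤ) ^ n) *
          (((Finset.range (n + 1)).sup fun i => p ^ (n - i) * ν i : ℕ) : ℤ)) : ℤ) : WithTop ℤ) ↔
      ν n = (Finset.range (n + 1)).sup fun i => p ^ (n - i) * ν i) := by
  obtain ⟨h0, hmul, hadd⟩ := hv
  have h1 : v 1 = 0 := by
    obtain ⟨d, hd⟩ := WithTop.ne_top_iff_exists.mp (fun h => one_ne_zero ((h0 1).mp h))
    have h := hmul 1 1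
    rw [mul_one, ← hd] at h
    rw [← hd]
    norm_cast at h ⊢
    omega
  let w : AddValuation L (WithTop ℤ) := .of v ((h0 0).mpr rfl) h1 hadd hmul
  have hmem : ∀ i, y.coeff i ∈ L := fun i => by
    rw [hL]
    exact IntermediateField.subset_adjoin K _ ⟨i, rfl⟩
  let y' : TruncatedWittVector p (n + 1) L := .mk p fun i => ⟨y.coeff i, hmem i⟩
  let u' : TruncatedWittVector p (n + 1) L := .mk p fun i => algebraMap K L (u.coeff i)
  have hy' : ∀ i ≤ n, y'.out.coeff i ^ p = (y'.out + u'.out).coeff i := fun i hi => by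
    have hF := sub_eq_iff_eq_add'.mp hy
    rw [← TruncatedWittVector.truncateFun_out y,
      ← TruncatedWittVector.truncateFun_out (twMap p (n + 1) (algebraMap K Ω) u),
      ← WittVector.truncateFun_add, TruncatedWittVector.truncateFun_out] at hF
    have hFi := congrArg (TruncatedWittVector.coeff ⟨i, Nat.lt_succ_of_le hi⟩) hF
    rw [WittVector.coeff_truncateFun] at hFi
    have e1 : y.out = WittVector.map (algebraMap L Ω) y'.out := out_twMap (algebraMap L Ω) y'
    have e2 : (twMap p (n + 1) (algebraMap K Ω) u).out =
        WittVector.map (algebraMap L Ω) u'.out :=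
      out_twMap (algebraMap L Ω) u'
    rw [e1, e2, ← map_add, WittVector.map_coeff] at hFi
    apply (algebraMap L Ω).injective
    rw [← hFi, map_pow,
      show y'.out.coeff i = _ from TruncatedWittVector.coeff_out y' ⟨i, Nat.lt_succ_of_le hi⟩]
    rfl
  have hu' : ∀ i ≤ n, w (u'.out.coeff i) = ((-(p ^ (n + 1) * ν i) : ℤ) : WithTop ℤ) :=
    fun i hi => by
      rw [show u'.out.coeff i = _ from
        TruncatedWittVector.coeff_out u' ⟨i, Nat.lt_succ_of_le hi⟩]
      refine (hvK _ (hu ⟨i, Nat.lt_succ_of_le hi⟩)).trans ?_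
      rw [hord, mul_neg]
  have hmain := w.artinSchreierWitt (t := t) ht n (fun i hi => (hν i hi).1) y'.out u'.out hy' hu'
    n le_rfl
  rwa [show y'.out.coeff n = ⟨y.coeff (Fin.last n), hyn⟩ from
    TruncatedWittVector.coeff_out y' (Fin.last n)] at hmain
end
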